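/- arXiv:1909.00048 — 2 statements merged into one kernel-verified Lean document; each statement's English description precedes it below -/
import Mathlib

section
/- Let γ be a simple closed curve in X. Then Int γ extends geodesics to γ: every X-geodesic [p,q]_X contained in Int γ extends to an X-geodesic [p,q']_X with [p,q]_X ⊆ [p,q']_X ⊆ γ ∪ Int γ, q' ∈ γ, and [p,q']_X \ {q'} ⊆ Int γ. -/
open Set Metric Filter

noncomputable section

namespace Cat2Cx

/-! ### Comparison angles -/

/-- Inverse hyperbolic cosine. -/
def arcosh (x : ℝ) : ℝ := Real.log (x + Real.sqrt (x ^ 2 - 1))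

/-- The Euclidean comparison angle at the vertex of a (comparison) triangle whose adjacent
sides have lengths `a`, `b` and whose opposite side has length `c`, via the law of cosines. -/
def euclCompAngle (a b c : ℝ) : ℝ :=
  Real.arccos ((a ^ 2 + b ^ 2 - c ^ 2) / (2 * a * b))

/-- The comparison angle in the model plane `M_κ²` of constant curvature `κ ≤ 0`, via the
(Euclidean or hyperbolic) law of cosines. -/
def compAngle (κ a b c : ℝ) : ℝ :=
  if κ = 0 then euclCompAngle a b c
  else
    Real.arccos
      ((Real.cosh (Real.sqrt (-κ) * a) * Real.cosh (Real.sqrt (-κ) * b) -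
          Real.cosh (Real.sqrt (-κ) * c)) /
        (Real.sinh (Real.sqrt (-κ) * a) * Real.sinh (Real.sqrt (-κ) * b)))

variable {Z : Type*}

/-! ### Geodesics with respect to a distance function -/

/-- `f` restricted to `[a,b]` is a unit-speed geodesic for the distance function `d`
(an isometric embedding of the compact interval `[a,b]`). -/
def IsGeodesicWrt (d : Z → Z → ℝ) (f : ℝ → Z) (a b : ℝ) : Prop :=
  a ≤ b ∧ ∀ s ∈ Icc a b, ∀ t ∈ Icc a b, d (f s) (f t) = |s - t|

/-- `f` is a unit-speed geodesic from `x` to `y` (for the distance function `d`),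
staying inside `S`. -/
def IsGeodesicFromTo (d : Z → Z → ℝ) (S : Set Z) (f : ℝ → Z) (x y : Z) : Prop :=
  f 0 = x ∧ f (d x y) = y ∧ IsGeodesicWrt d f 0 (d x y) ∧ MapsTo f (Icc 0 (d x y)) S

/-- `S`, with the distance function `d`, is a geodesic space. -/
def GeodesicSpaceWrt (d : Z → Z → ℝ) (S : Set Z) : Prop :=
  ∀ x ∈ S, ∀ y ∈ S, ∃ f, IsGeodesicFromTo d S f x y

/-- The geodesic segment `[x,y]`: the union of (the images of) all geodesics from `x` to `y`
inside `S`.  In a uniquely geodesic space this is the image of the unique geodesic. -/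
def geodSeg (d : Z → Z → ℝ) (S : Set Z) (x y : Z) : Set Z :=
  ⋃ f ∈ {f : ℝ → Z | IsGeodesicFromTo d S f x y}, f '' Icc 0 (d x y)

/-- `C ⊆ S` is geodesically convex with respect to `d`: every geodesic (in `S`) between two
points of `C` lies in `C`. -/
def ConvexWrtIn (d : Z → Z → ℝ) (S C : Set Z) : Prop :=
  ∀ x ∈ C, ∀ y ∈ C, geodSeg d S x y ⊆ C

/-- `C` is geodesically convex with respect to `d`. -/
abbrev ConvexWrt (d : Z → Z → ℝ) (C : Set Z) : Prop := ConvexWrtIn d univ C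

/-- The geodesically convex hull of `A` with respect to `d`. -/
def convexHullWrt (d : Z → Z → ℝ) (A : Set Z) : Set Z :=
  ⋂₀ {C | ConvexWrt d C ∧ A ⊆ C}

/-- The Alexandrov (upper) angle at `p` between two paths `σ`, `τ` issuing from `p`
(each parametrized so that `σ 0 = τ 0 = p`): the limit as `ε → 0⁺` (i.e. the infimum over
`ε > 0`) of the supremum over `0 < s, t < ε` of the Euclidean comparison angles. -/
def upperAngleWrt (d : Z → Z → ℝ) (p : Z) (σ τ : ℝ → Z) : ℝ :=
  sInf {a | ∃ ε > 0, a = sSup {b | ∃ s t : ℝ, 0 < s ∧ s < ε ∧ 0 < t ∧ t < ε ∧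
      b = euclCompAngle (d p (σ s)) (d p (τ t)) (d (σ s) (τ t))}}

/-- The CAT(κ) condition (for `κ ≤ 0`), in the angle-comparison form
(Bridson–Haefliger II.1.7(4)): `S` is geodesic and for every triple of distinct points the
Alexandrov angle between geodesics is at most the comparison angle in `M_κ²`. -/
def IsCATWrt (κ : ℝ) (d : Z → Z → ℝ) (S : Set Z) : Prop :=
  GeodesicSpaceWrt d S ∧
    ∀ p ∈ S, ∀ q ∈ S, ∀ r ∈ S, p ≠ q → p ≠ r → q ≠ r →
      ∀ σ τ : ℝ → Z, IsGeodesicFromTo d S σ p q → IsGeodesicFromTo d S τ p r →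
        upperAngleWrt d p σ τ ≤ compAngle κ (d p q) (d p r) (d q r)

/-- Completeness of `S` with respect to the distance function `d`:
every Cauchy sequence converges. -/
def CompleteWrt (d : Z → Z → ℝ) (S : Set Z) : Prop :=
  ∀ u : ℕ → Z, (∀ n, u n ∈ S) →
    (∀ ε > 0, ∃ N, ∀ m ≥ N, ∀ n ≥ N, d (u m) (u n) < ε) →
    ∃ x ∈ S, ∀ ε > 0, ∃ N, ∀ n ≥ N, d (u n) x < ε

variable {X : Type*} [MetricSpace X]

/-- `X` is a CAT(κ) metric space. -/
def IsCATSpace (κ : ℝ) (X : Type*) [MetricSpace X] : Prop :=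
  IsCATWrt κ (fun x y : X => dist x y) univ

/-- The distance function of the metric space `X`. -/
abbrev xDist (X : Type*) [MetricSpace X] : X → X → ℝ := fun x y => dist x y

/-! ### The model plane `M_κ²` and polyhedral 2-complexes -/

/-- The distance function of the model plane `M_κ²` of constant curvature `κ ≤ 0`, in global
coordinates `ℝ²`: the Euclidean distance for `κ = 0`, and for `κ < 0` the distance of the
hyperboloid model rescaled by `1/√(-κ)` (so that the curvature is `κ`). -/
def mDist (κ : ℝ) (u v : ℝ × ℝ) : ℝ :=
  if κ = 0 then Real.sqrt ((u.1 - v.1) ^ 2 + (u.2 - v.2) ^ 2)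
  else
    (1 / Real.sqrt (-κ)) *
      arcosh (Real.sqrt (1 + u.1 ^ 2 + u.2 ^ 2) * Real.sqrt (1 + v.1 ^ 2 + v.2 ^ 2) -
        u.1 * v.1 - u.2 * v.2)

/-- A convex polygonal 2-cell in `M_κ²`: the geodesically convex hull of a finite set of
points, with nonempty interior. -/
def IsPolygonalCell (κ : ℝ) (P : Set (ℝ × ℝ)) : Prop :=
  ∃ F : Finset (ℝ × ℝ), P = convexHullWrt (mDist κ) (F : Set (ℝ × ℝ)) ∧ (interior P).Nonempty

/-- The subset `S` of `X` embeds isometrically into the model plane `M_κ²`. -/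
def IsomEmbedsInModelPlane (κ : ℝ) (S : Set X) : Prop :=
  ∃ f : X → ℝ × ℝ, ∀ x ∈ S, ∀ y ∈ S, mDist κ (f x) (f y) = dist x y

/-- A locally finite `M_κ`-polyhedral 2-complex structure on the metric space `X`:
`X` is partitioned into open 2-cells (faces), open 1-cells (edges) and vertices; the closure of
each face is isometric to a compact convex polygon of the model plane `M_κ²` (so each face has
constant curvature `κ`), each edge is a geodesic arc, and the complex is locally finite. -/
structure PolyComplex2 (κ : ℝ) (X : Type*) [MetricSpace X] where
  faces : Set (Set X)
  edges : Set (Set X)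
  vertices : Set X
  faces_open : ∀ F ∈ faces, IsOpen F
  cover : ⋃₀ faces ∪ ⋃₀ edges ∪ vertices = univ
  cells_disjoint : ∀ c ∈ faces ∪ edges, ∀ c' ∈ faces ∪ edges, c ≠ c' → c ∩ c' = ∅
  cells_vertex_disjoint : ∀ c ∈ faces ∪ edges, c ∩ vertices = ∅
  face_chart : ∀ F ∈ faces, ∃ (f : X → ℝ × ℝ) (P : Set (ℝ × ℝ)),
    IsPolygonalCell κ P ∧ InjOn f (closure F) ∧ f '' closure F = P ∧ f '' F = interior P ∧
    ∀ x ∈ closure F, ∀ y ∈ closure F, mDist κ (f x) (f y) = dist x y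
  edge_geodesic : ∀ e ∈ edges, ∃ (f : ℝ → X) (L : ℝ), 0 < L ∧
    IsGeodesicWrt (fun x y : X => dist x y) f 0 L ∧ f '' Ioo 0 L = e
  edge_closure : ∀ e ∈ edges, closure e \ e ⊆ vertices
  face_closure : ∀ F ∈ faces, closure F \ F ⊆ ⋃₀ edges ∪ vertices
  locally_finite : ∀ x : X, ∃ ε > 0,
    {c | (c ∈ faces ∨ c ∈ edges) ∧ (c ∩ ball x ε).Nonempty}.Finite ∧
    (vertices ∩ ball x ε).Finite

/-! ### Simple closed curves, their interiors, and first homology -/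

/-- A simple closed curve in `X` (identified with its image). -/
structure SCC (X : Type*) [TopologicalSpace X] where
  toFun : ℝ → X
  contOn : ContinuousOn toFun (Icc 0 1)
  loop : toFun 0 = toFun 1
  inj : InjOn toFun (Ico 0 1)

/-- The image of a simple closed curve. -/
def SCC.img {X : Type*} [TopologicalSpace X] (γ : SCC X) : Set X := γ.toFun '' Icc 0 1

/-- The first singular homology class of a loop, via the Hurewicz isomorphism: the class of
the loop in the abelianization of the fundamental group (of its path component); the loop is
nullhomologous iff this class is trivial. -/
def loopClassH1 {B : Type*} [TopologicalSpace B] {x : B} (p : Path x x) :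
    Abelianization (FundamentalGroup B x) :=
  Abelianization.of (FundamentalGroup.fromPath (X := TopCat.of B) ⟦p⟧)

/-- The basepoint of a simple closed curve, regarded in a subspace `B` containing it. -/
def SCC.basePoint {X : Type*} [TopologicalSpace X] (γ : SCC X) (B : Set X)
    (h : γ.img ⊆ B) : B :=
  ⟨γ.toFun 0, h ⟨0, ⟨le_rfl, zero_le_one⟩, rfl⟩⟩

/-- The loop of a simple closed curve, as a `Path` in a subspace `B` containing it. -/
def SCC.pathIn {X : Type*} [TopologicalSpace X] (γ : SCC X) (B : Set X) (h : γ.img ⊆ B) :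
    Path (γ.basePoint B h) (γ.basePoint B h) where
  toFun t := ⟨γ.toFun t, h ⟨(t : ℝ), t.2, rfl⟩⟩
  continuous_toFun := by
    apply Continuous.subtype_mk
    exact γ.contOn.comp_continuous continuous_subtype_val fun t => t.2
  source' := by
    apply Subtype.ext
    rfl
  target' := by
    apply Subtype.ext
    exact γ.loop.symm

/-- The simple closed curve `γ` is nullhomologous in the subspace `B` of `X`:
its class in `H₁(B)` vanishes. -/
def SCC.NullhomologousIn {X : Type*} [TopologicalSpace X] (γ : SCC X) (B : Set X) : Prop :=
  ∀ h : γ.img ⊆ B, loopClassH1 (γ.pathIn B h) = 1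

/-- The interior of a simple closed curve `γ`:
`Int γ = {x ∈ X \ γ | [γ] ≠ 0 ∈ H₁(X \ {x})}`. -/
def SCC.interiorSet {X : Type*} [TopologicalSpace X] (γ : SCC X) : Set X :=
  {x | x ∉ γ.img ∧ ¬ γ.NullhomologousIn {x}ᶜ}

/-- The first singular homology of `B` vanishes: every loop in `B` is nullhomologous
(via the Hurewicz isomorphism on each path component). -/
def H1Trivial (B : Type*) [TopologicalSpace B] : Prop :=
  ∀ (x : B) (p : Path x x), loopClassH1 p = 1

/-! ### Rectifiable connectedness and the induced path metric -/

/-- `g` is a path from `x` to `y` (parametrized by `[0,1]`) inside `E`. -/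
def IsPathIn {X : Type*} [TopologicalSpace X] (E : Set X) (g : ℝ → X) (x y : X) : Prop :=
  ContinuousOn g (Icc 0 1) ∧ g 0 = x ∧ g 1 = y ∧ MapsTo g (Icc 0 1) E

/-- `E` is rectifiably connected: any two of its points are joined by a rectifiable
(finite length) path in `E`. -/
def RectConnected {X : Type*} [MetricSpace X] (E : Set X) : Prop :=
  ∀ x ∈ E, ∀ y ∈ E, ∃ g : ℝ → X, IsPathIn E g x y ∧ eVariationOn g (Icc 0 1) ≠ ⊤

/-- The induced path metric on `E`: the infimum of the lengths of rectifiable paths in `E`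
joining the two points. -/
def pathDistIn {X : Type*} [MetricSpace X] (E : Set X) (x y : X) : ℝ :=
  (⨅ g : {g : ℝ → X // IsPathIn E g x y}, eVariationOn g.1 (Icc 0 1)).toReal


universe u
/-! ### Conical neighborhoods -/


/-- The distance function of the `κ`-cone (κ ≤ 0) over a space with distance function `dL`:
a point is a pair (radius, link point), all points of radius `0` being identified (the cone
point); the distance is given by the law of cosines in curvature `κ`, with angle
`min π (dL ℓ ℓ')`. -/
def coneDist (κ : ℝ) {L : Type*} (dL : L → L → ℝ) (a b : ℝ × L) : ℝ :=
  if κ = 0 then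
    Real.sqrt (a.1 ^ 2 + b.1 ^ 2 - 2 * a.1 * b.1 * Real.cos (min Real.pi (dL a.2 b.2)))
  else
    (1 / Real.sqrt (-κ)) *
      arcosh (Real.cosh (Real.sqrt (-κ) * a.1) * Real.cosh (Real.sqrt (-κ) * b.1) -
        Real.sinh (Real.sqrt (-κ) * a.1) * Real.sinh (Real.sqrt (-κ) * b.1) *
          Real.cos (min Real.pi (dL a.2 b.2)))

/-- `V` is a conical neighborhood of `p` in `X`: an open neighborhood of `p` isometric to a
convex open subset of the `κ`-cone over a metric space (the link of `p`), the isometry taking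
`p` to the cone point. -/
def IsConicalNbhd (κ : ℝ) (p : X) (V : Set X) : Prop :=
  IsOpen V ∧ p ∈ V ∧
    ∃ (L : Type u) (dL : L → L → ℝ) (f : X → ℝ × L),
      (∀ a, dL a a = 0) ∧ (∀ a b, 0 ≤ dL a b) ∧ (∀ a b, dL a b = dL b a) ∧
      (∀ a b c, dL a c ≤ dL a b + dL b c) ∧
      (∀ x ∈ V, 0 ≤ (f x).1) ∧ (f p).1 = 0 ∧
      (∀ x ∈ V, ∀ y ∈ V, dist x y = coneDist κ dL (f x) (f y)) ∧
      (∀ x ∈ V, (f x).1 = 0 → x = p) ∧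
      ConvexWrtIn (coneDist κ dL) {w : ℝ × L | 0 ≤ w.1} (f '' V) ∧
      (∀ z ∈ f '' V, ∃ ε > 0, ∀ w : ℝ × L, 0 ≤ w.1 → coneDist κ dL z w < ε → w ∈ f '' V)

/-! ### Geodesics, triangles, and limit segments in `Y = (E, induced path metric)` -/

/-- The set `α` is (the image of) a geodesic arc of `Y = (E, pathDistIn E)`. -/
def IsYGeodesicArc (E : Set X) (α : Set X) : Prop :=
  ∃ (f : ℝ → X) (a b : ℝ), IsGeodesicWrt (pathDistIn E) f a b ∧
    MapsTo f (Icc a b) E ∧ f '' Icc a b = α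

/-- `T` is a geodesic triangle of `Y = (E, pathDistIn E)` with vertices `p`, `q`, `r`:
the union of the three `Y`-geodesics joining the vertices. -/
def IsYTriangle (E : Set X) (T : Set X) (p q r : X) : Prop :=
  p ∈ E ∧ q ∈ E ∧ r ∈ E ∧
    T = geodSeg (pathDistIn E) E p q ∪ geodSeg (pathDistIn E) E q r ∪
        geodSeg (pathDistIn E) E r p

/-- The set `γim` (a curve in `E`) is locally geodesic in `Y` at `p`: some subarc of `γim`
containing `p` in its relative interior is a geodesic of `Y`. -/
def LocallyYGeodesicAt (E γim : Set X) (p : X) : Prop :=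
  ∃ (f : ℝ → X) (a b t : ℝ), t ∈ Ioo a b ∧ f t = p ∧
    IsGeodesicWrt (pathDistIn E) f a b ∧ MapsTo f (Icc a b) E ∧ f '' Icc a b ⊆ γim

/-- `f : [0,1] → E` is the constant-speed parametrization of the `Y`-geodesic
from `x` to `y`. -/
def IsConstSpeedYGeodesic (E : Set X) (f : ℝ → X) (x y : X) : Prop :=
  f 0 = x ∧ f 1 = y ∧ MapsTo f (Icc 0 1) E ∧
    ∀ s ∈ Icc (0:ℝ) 1, ∀ t ∈ Icc (0:ℝ) 1,
      pathDistIn E (f s) (f t) = pathDistIn E x y * |s - t|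

/-- `R` is the limit segment of length `ε` at `p` of the `Y`-geodesic side from `p` to `q`:
`R` is an `X`-geodesic of length `ε` issuing from `p`, and the `X`-geodesics of length `ε`
from `p` through `σ t` (σ the `Y`-geodesic from `p` to `q`) converge uniformly to `R`
as `t → 0⁺`. -/
def IsLimitSegment (E : Set X) (p q : X) (ε : ℝ) (R : ℝ → X) : Prop :=
  0 < ε ∧ R 0 = p ∧ IsGeodesicWrt (fun x y : X => dist x y) R 0 ε ∧
    ∀ σ : ℝ → X, IsGeodesicFromTo (pathDistIn E) E σ p q →
      ∀ δ > 0, ∃ t₀ > 0, ∀ t, 0 < t → t ≤ t₀ → t ≤ pathDistIn E p q →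
        ∀ g : ℝ → X, IsGeodesicWrt (fun x y : X => dist x y) g 0 ε → g 0 = p →
          g (dist p (σ t)) = σ t → ∀ s ∈ Icc 0 ε, dist (g s) (R s) ≤ δ


end Cat2Cx

end

namespace Cat2Cx

/-! ### Comparison of hyperbolic and Euclidean angles -/

lemma cosh_le_of_sq_eq_combination {a b c l : ℝ} (h0 : 0 ≤ l) (h1 : l ≤ 1)
    (hc : c ^ 2 = (1 - l) * a ^ 2 + l * b ^ 2) :
    Real.cosh c ≤ (1 - l) * Real.cosh a + l * Real.cosh b := by
  have ha := (Real.hasSum_cosh a).mul_left (1 - l)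
  have hb := (Real.hasSum_cosh b).mul_left l
  refine hasSum_le (fun n => ?_) (Real.hasSum_cosh c) (ha.add hb)
  have hconv := (convexOn_pow (𝕜 := ℝ) n).2 (x := a ^ 2) (sq_nonneg a) (y := b ^ 2) (sq_nonneg b)
    (sub_nonneg.2 h1) h0 (by ring)
  simp only [smul_eq_mul] at hconv
  rw [← hc, ← pow_mul, ← pow_mul, ← pow_mul] at hconv
  have hf : (0 : ℝ) < ((2 * n).factorial : ℝ) := by positivity
  calc c ^ (2 * n) / ((2 * n).factorial : ℝ)
      ≤ ((1 - l) * a ^ (2 * n) + l * b ^ (2 * n)) / ((2 * n).factorial : ℝ) := by gcongr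
    _ = _ := by ring

lemma euclidean_cos_le_hyperbolic_cos {a b c : ℝ} (ha : 0 < a) (hb : 0 < b) (hc : 0 ≤ c)
    (h1 : |a - b| ≤ c) (h2 : c ≤ a + b) :
    (a ^ 2 + b ^ 2 - c ^ 2) / (2 * a * b) ≤
      (Real.cosh a * Real.cosh b - Real.cosh c) / (Real.sinh a * Real.sinh b) := by
  have hab : 0 < a * b := mul_pos ha hb
  have hlo : (a - b) ^ 2 ≤ c ^ 2 := by
    rw [← sq_abs (a - b)]; gcongr
  have hhi : c ^ 2 ≤ (a + b) ^ 2 := by gcongr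
  set l := (c ^ 2 - (a - b) ^ 2) / (4 * (a * b)) with hl
  have hl0 : 0 ≤ l := div_nonneg (by linarith) (by positivity)
  have hl1 : l ≤ 1 := by rw [hl, div_le_one (by positivity)]; nlinarith
  have hlm : l * (4 * (a * b)) = c ^ 2 - (a - b) ^ 2 := by rw [hl]; field_simp
  have key := cosh_le_of_sq_eq_combination (a := a - b) (b := a + b) (c := c) hl0 hl1
    (by nlinarith)
  rw [Real.cosh_sub, Real.cosh_add] at key
  have hs : 0 < Real.sinh a * Real.sinh b :=
    mul_pos (Real.sinh_pos_iff.2 ha) (Real.sinh_pos_iff.2 hb)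
  have hlhs : (a ^ 2 + b ^ 2 - c ^ 2) / (2 * a * b) = 1 - 2 * l := by
    rw [div_eq_iff (by positivity)]; nlinarith
  rw [hlhs, le_div_iff₀ hs]
  nlinarith

lemma compAngle_le_euclCompAngle {κ : ℝ} (hκ : κ ≤ 0) {a b c : ℝ} (ha : 0 < a) (hb : 0 < b)
    (hc : 0 ≤ c) (h1 : |a - b| ≤ c) (h2 : c ≤ a + b) :
    compAngle κ a b c ≤ euclCompAngle a b c := by
  unfold compAngle
  split_ifs with h
  · exact le_rfl
  · have hk : 0 < Real.sqrt (-κ) := Real.sqrt_pos.2 (by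
      have : κ < 0 := lt_of_le_of_ne hκ h
      linarith)
    set k := Real.sqrt (-κ)
    refine Real.arccos_le_arccos ?_
    have := euclidean_cos_le_hyperbolic_cos (a := k * a) (b := k * b) (c := k * c)
      (by positivity) (by positivity) (by positivity)
      (by rw [← mul_sub, abs_mul, abs_of_pos hk]; gcongr) (by nlinarith)
    refine le_trans (le_of_eq ?_) this
    field_simp

/-! ### The CAT(0) inequality -/

lemma euclCompAngle_mem_Icc (a b c : ℝ) : euclCompAngle a b c ∈ Icc 0 Real.pi :=
  ⟨Real.arccos_nonneg _, Real.arccos_le_pi _⟩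

lemma exists_forall_lt_of_upperAngleWrt_lt {Z : Type*} {d : Z → Z → ℝ} {p : Z} {σ τ : ℝ → Z}
    {α : ℝ} (h : upperAngleWrt d p σ τ < α) :
    ∃ ε > 0, ∀ s t : ℝ, 0 < s → s < ε → 0 < t → t < ε →
      euclCompAngle (d p (σ s)) (d p (τ t)) (d (σ s) (τ t)) < α := by
  obtain ⟨_, ⟨ε, hε, rfl⟩, hlt⟩ := exists_lt_of_csInf_lt (by exact ⟨_, 1, one_pos, rfl⟩) h
  refine ⟨ε, hε, fun s t hs hs' ht ht' => lt_of_le_of_lt (le_csSup ?_ ?_) hlt⟩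
  · refine ⟨Real.pi, ?_⟩
    rintro _ ⟨s, t, -, -, -, -, rfl⟩
    exact (euclCompAngle_mem_Icc _ _ _).2
  · exact ⟨s, t, hs, hs', ht, ht', rfl⟩

lemma upperAngleWrt_nonneg {Z : Type*} (d : Z → Z → ℝ) (p : Z) (σ τ : ℝ → Z) :
    0 ≤ upperAngleWrt d p σ τ := by
  refine Real.sInf_nonneg ?_
  rintro _ ⟨ε, -, rfl⟩
  refine Real.sSup_nonneg ?_
  rintro _ ⟨s, t, -, -, -, -, rfl⟩
  exact (euclCompAngle_mem_Icc _ _ _).1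

lemma sq_le_of_euclCompAngle_lt {s t D α : ℝ} (hs : 0 < s) (ht : 0 < t) (hα0 : 0 ≤ α)
    (hα : α ≤ Real.pi) (h : euclCompAngle s t D < α) :
    D ^ 2 ≤ s ^ 2 + t ^ 2 - 2 * s * t * Real.cos α := by
  have h1 : Real.cos α ≤ (s ^ 2 + t ^ 2 - D ^ 2) / (2 * s * t) := by
    by_contra hcon
    have := Real.arccos_le_arccos (not_le.1 hcon).le
    rw [Real.arccos_cos hα0 hα] at this
    exact absurd h (not_lt.2 this)
  rw [le_div_iff₀ (by positivity)] at h1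
  linarith

variable {X : Type*} [MetricSpace X]

lemma IsGeodesicFromTo.dist_left {f : ℝ → X} {x y : X}
    (h : IsGeodesicFromTo (fun x y : X => dist x y) univ f x y) {s : ℝ} (h0 : 0 ≤ s)
    (h1 : s ≤ dist x y) : dist x (f s) = s := by
  obtain ⟨hx, -, ⟨-, hf⟩, -⟩ := h
  have := hf 0 ⟨le_rfl, dist_nonneg⟩ s ⟨h0, h1⟩
  rw [hx] at this
  simpa [abs_of_nonneg h0] using this

lemma IsGeodesicFromTo.dist_right {f : ℝ → X} {x y : X}
    (h : IsGeodesicFromTo (fun x y : X => dist x y) univ f x y) {s : ℝ} (h0 : 0 ≤ s)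
    (h1 : s ≤ dist x y) : dist (f s) y = dist x y - s := by
  obtain ⟨-, hy, ⟨-, hf⟩, -⟩ := h
  have := hf s ⟨h0, h1⟩ (dist x y) ⟨dist_nonneg, le_rfl⟩
  rw [hy] at this
  change dist (f s) y = _ at this
  rw [this, abs_sub_comm, abs_of_nonneg (by linarith)]

lemma false_of_short_detour {s t D E A B : ℝ} (hs : 0 < s) (ht : 0 < t) (htk : t < s * (A + B))
    (hD : D ^ 2 ≤ s ^ 2 + t ^ 2 - 2 * s * t * A) (hE : E ^ 2 ≤ s ^ 2 + t ^ 2 - 2 * s * t * B)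
    (h : 2 * s ≤ D + E) : False := by
  have h1 : (2 * s) ^ 2 ≤ (D + E) ^ 2 := by gcongr
  have h2 : t * t < t * (s * (A + B)) := by gcongr
  nlinarith [sq_nonneg (D - E)]

/-- The two angles at an interior point of a geodesic add up to at least `π`. -/
lemma pi_le_upperAngle_add {a b c y : X} (hab : b ≠ a) (hcb : b ≠ c) (hyb : b ≠ y)
    (hbtw : dist a b + dist b c = dist a c) {σ τ η : ℝ → X}
    (hσ : IsGeodesicFromTo (fun x y : X => dist x y) univ σ b a)
    (hτ : IsGeodesicFromTo (fun x y : X => dist x y) univ τ b c)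
    (hη : IsGeodesicFromTo (fun x y : X => dist x y) univ η b y) :
    Real.pi ≤ upperAngleWrt (fun x y : X => dist x y) b σ η +
      upperAngleWrt (fun x y : X => dist x y) b τ η := by
  by_contra hcon
  rw [not_le] at hcon
  have hα0 := upperAngleWrt_nonneg (fun x y : X => dist x y) b σ η
  have hβ0 := upperAngleWrt_nonneg (fun x y : X => dist x y) b τ η
  obtain ⟨α, hα⟩ : ∃ α, α = upperAngleWrt (fun x y : X => dist x y) b σ η := ⟨_, rfl⟩
  obtain ⟨β, hβ⟩ : ∃ β, β = upperAngleWrt (fun x y : X => dist x y) b τ η := ⟨_, rfl⟩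
  rw [← hα] at hα0 hcon
  rw [← hβ] at hβ0 hcon
  obtain ⟨g, hg⟩ : ∃ g, g = (Real.pi - (α + β)) / 4 := ⟨_, rfl⟩
  have hgpos : 0 < g := by rw [hg]; linarith
  obtain ⟨ε₁, hε₁, h₁⟩ := exists_forall_lt_of_upperAngleWrt_lt (α := α + g)
    (show upperAngleWrt (fun x y : X => dist x y) b σ η < α + g by linarith)
  obtain ⟨ε₂, hε₂, h₂⟩ := exists_forall_lt_of_upperAngleWrt_lt (α := β + g)
    (show upperAngleWrt (fun x y : X => dist x y) b τ η < β + g by linarith)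
  have hk : 0 < Real.cos (α + g) + Real.cos (β + g) := by
    have : Real.cos (Real.pi - (β + g)) < Real.cos (α + g) :=
      Real.cos_lt_cos_of_nonneg_of_le_pi (by linarith) (by linarith) (by linarith)
    rw [Real.cos_pi_sub] at this
    linarith
  obtain ⟨k, hkdef⟩ : ∃ k, k = Real.cos (α + g) + Real.cos (β + g) := ⟨_, rfl⟩
  rw [← hkdef] at hk
  have hk2 : k ≤ 2 := by
    have := Real.cos_le_one (α + g); have := Real.cos_le_one (β + g); linarith
  have hda : 0 < dist b a := dist_pos.2 hab
  have hdc : 0 < dist b c := dist_pos.2 hcb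
  have hdy : 0 < dist b y := dist_pos.2 hyb
  obtain ⟨s, hs0, hs⟩ : ∃ s, 0 < s ∧ s < min (min ε₁ ε₂) (min (dist b a) (min (dist b c) (dist b y))) :=
    exists_between (by positivity)
  simp only [lt_min_iff] at hs
  obtain ⟨⟨hs1, hs2⟩, hsa, hsc, hsy⟩ := hs
  have ht0 : 0 < s * k / 2 := by positivity
  have hts : s * k / 2 ≤ s := by nlinarith
  obtain ⟨t, ht⟩ : ∃ t, t = s * k / 2 := ⟨_, rfl⟩
  rw [← ht] at ht0 hts
  have e1 : dist b (σ s) = s := hσ.dist_left hs0.le hsa.le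
  have e2 : dist b (τ s) = s := hτ.dist_left hs0.le hsc.le
  have e3 : dist b (η t) = t := hη.dist_left ht0.le (by linarith)
  have b1 := h₁ s t hs0 hs1 ht0 (by linarith)
  have b2 := h₂ s t hs0 hs2 ht0 (by linarith)
  simp only [e1, e2, e3] at b1 b2
  have q1 := sq_le_of_euclCompAngle_lt hs0 ht0 (by linarith) (by linarith) b1
  have q2 := sq_le_of_euclCompAngle_lt hs0 ht0 (by linarith) (by linarith) b2
  have f1 : dist (σ s) a = dist b a - s := hσ.dist_right hs0.le hsa.le
  have f2 : dist (τ s) c = dist b c - s := hτ.dist_right hs0.le hsc.le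
  have tri : dist a c ≤ dist a (σ s) + dist (σ s) (η t) + dist (η t) (τ s) + dist (τ s) c := by
    have := dist_triangle4 a (σ s) (η t) c
    have := dist_triangle (η t) (τ s) c
    linarith
  rw [dist_comm a (σ s), dist_comm (η t) (τ s), f1, f2] at tri
  rw [dist_comm a b] at hbtw
  have sum2 : 2 * s ≤ dist (σ s) (η t) + dist (τ s) (η t) := by linarith
  exact false_of_short_detour hs0 ht0 (by rw [← hkdef]; nlinarith) q1 q2 sum2

/-- A geodesic metric space satisfying Stewart's inequality. -/
class CATZero (X : Type*) [MetricSpace X] : Prop where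
  exists_between : ∀ x y : X, ∀ t ∈ Icc (0 : ℝ) 1, ∃ z, dist x z = t * dist x y ∧
    dist z y = (1 - t) * dist x y
  stewart : ∀ a b c y : X, dist a b + dist b c = dist a c →
    dist a c * dist b y ^ 2 ≤ dist b c * dist a y ^ 2 + dist a b * dist c y ^ 2 -
      dist a b * dist b c * dist a c

lemma cos_euclCompAngle {a b c : ℝ} (ha : 0 < a) (hb : 0 < b) (hc : 0 ≤ c)
    (h1 : |a - b| ≤ c) (h2 : c ≤ a + b) :
    Real.cos (euclCompAngle a b c) = (a ^ 2 + b ^ 2 - c ^ 2) / (2 * a * b) := by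
  have hlo : (a - b) ^ 2 ≤ c ^ 2 := by
    rw [← sq_abs (a - b)]; gcongr
  have hhi : c ^ 2 ≤ (a + b) ^ 2 := by gcongr
  refine Real.cos_arccos ?_ ?_
  · rw [le_div_iff₀ (by positivity)]; nlinarith
  · rw [div_le_one (by positivity)]; nlinarith

lemma abs_dist_sub_dist_le (b a y : X) : |dist b a - dist b y| ≤ dist a y := by
  rw [abs_le]
  constructor <;>
    linarith [dist_triangle b a y, dist_triangle b y a, dist_comm a y]

lemma IsCATSpace.catZero {κ : ℝ} (hκ : κ ≤ 0) (hX : IsCATSpace κ X) : CATZero X where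
  exists_between x y t ht := by
    obtain ⟨f, hf⟩ := hX.1 x (mem_univ _) y (mem_univ _)
    have h0 : 0 ≤ t * dist x y := mul_nonneg ht.1 dist_nonneg
    have h1 : t * dist x y ≤ dist x y := mul_le_of_le_one_left dist_nonneg ht.2
    exact ⟨f (t * dist x y), hf.dist_left h0 h1, by rw [hf.dist_right h0 h1]; ring⟩
  stewart a b c y hbtw := by
    rcases eq_or_ne b a with rfl | hba
    · simp
    rcases eq_or_ne b c with rfl | hbc
    · simp [mul_comm]
    rcases eq_or_ne b y with rfl | hby
    · rw [← hbtw, dist_comm c b, dist_self]; nlinarith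
    rcases eq_or_ne a y with rfl | hay
    · rw [← hbtw, dist_comm b a, dist_self, dist_comm c a, ← hbtw]; nlinarith
    rcases eq_or_ne c y with rfl | hcy
    · rw [← hbtw, dist_self]; nlinarith
    obtain ⟨σ, hσ⟩ := hX.1 b (mem_univ _) a (mem_univ _)
    obtain ⟨τ, hτ⟩ := hX.1 b (mem_univ _) c (mem_univ _)
    obtain ⟨η, hη⟩ := hX.1 b (mem_univ _) y (mem_univ _)
    have hpi := pi_le_upperAngle_add hba hbc hby hbtw hσ hτ hη
    have hA : 0 < dist b a := dist_pos.2 hba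
    have hC : 0 < dist b c := dist_pos.2 hbc
    have hm : 0 < dist b y := dist_pos.2 hby
    have t1 : dist a y ≤ dist b a + dist b y := by
      linarith [dist_triangle a b y, dist_comm a b]
    have t2 : dist c y ≤ dist b c + dist b y := by
      linarith [dist_triangle c b y, dist_comm c b]
    have c1 := (hX.2 b (mem_univ _) a (mem_univ _) y (mem_univ _) hba hby hay σ η hσ hη).trans
      (compAngle_le_euclCompAngle hκ hA hm dist_nonneg (abs_dist_sub_dist_le b a y) t1)
    have c2 := (hX.2 b (mem_univ _) c (mem_univ _) y (mem_univ _) hbc hby hcy τ η hτ hη).trans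
      (compAngle_le_euclCompAngle hκ hC hm dist_nonneg (abs_dist_sub_dist_le b c y) t2)
    have k1 := cos_euclCompAngle hA hm dist_nonneg (abs_dist_sub_dist_le b a y) t1
    have k2 := cos_euclCompAngle hC hm dist_nonneg (abs_dist_sub_dist_le b c y) t2
    have hcos : Real.cos (euclCompAngle (dist b a) (dist b y) (dist a y)) +
        Real.cos (euclCompAngle (dist b c) (dist b y) (dist c y)) ≤ 0 := by
      have := Real.cos_le_cos_of_nonneg_of_le_pi
        (x := Real.pi - euclCompAngle (dist b c) (dist b y) (dist c y))
        (y := euclCompAngle (dist b a) (dist b y) (dist a y))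
        (by linarith [(euclCompAngle_mem_Icc (dist b c) (dist b y) (dist c y)).2])
        (euclCompAngle_mem_Icc _ _ _).2 (by linarith)
      rw [Real.cos_pi_sub] at this
      linarith
    rw [k1, k2, div_add_div _ _ (by positivity) (by positivity),
      div_le_iff₀ (by positivity), zero_mul] at hcos
    rw [← hbtw, dist_comm a b]
    have hcos' : dist b c * (dist b a ^ 2 + dist b y ^ 2 - dist a y ^ 2) +
        dist b a * (dist b c ^ 2 + dist b y ^ 2 - dist c y ^ 2) ≤ 0 := by
      by_contra hc
      nlinarith
    nlinarith

section Geo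
variable {X : Type*} [MetricSpace X] [CATZero X]

/-- Truncation of a real parameter to `[0,1]`. -/
noncomputable def clamp (t : ℝ) : ℝ := max 0 (min 1 t)

lemma clamp_mem (t : ℝ) : clamp t ∈ Icc (0 : ℝ) 1 :=
  ⟨le_max_left _ _, max_le zero_le_one (min_le_left _ _)⟩

lemma clamp_of_mem {t : ℝ} (ht : t ∈ Icc (0 : ℝ) 1) : clamp t = t := by
  simp [clamp, ht.1, ht.2]

@[fun_prop]
lemma continuous_clamp : Continuous clamp := by unfold clamp; fun_prop

/-- The point at parameter `t` (truncated to `[0,1]`) on the geodesic from `x` to `y`. -/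
noncomputable def geo (x y : X) (t : ℝ) : X :=
  (CATZero.exists_between x y (clamp t) (clamp_mem t)).choose

lemma dist_left_geo (x y : X) (t : ℝ) : dist x (geo x y t) = clamp t * dist x y :=
  (CATZero.exists_between x y (clamp t) (clamp_mem t)).choose_spec.1

lemma dist_geo_right (x y : X) (t : ℝ) : dist (geo x y t) y = (1 - clamp t) * dist x y :=
  (CATZero.exists_between x y (clamp t) (clamp_mem t)).choose_spec.2

lemma dist_geo_add (x y : X) (t : ℝ) :
    dist x (geo x y t) + dist (geo x y t) y = dist x y := by
  rw [dist_left_geo, dist_geo_right]; ring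

lemma eq_of_between {x y z z' : X} (h : dist x z + dist z y = dist x y)
    (h' : dist x z' + dist z' y = dist x y) (hz : dist x z = dist x z') : z = z' := by
  rcases eq_or_ne x y with rfl | hxy
  · rw [dist_self, dist_comm z] at h
    have h1 : dist x z = 0 := by linarith
    have h2 : dist x z' = 0 := by linarith
    rw [← dist_eq_zero.1 h1, ← dist_eq_zero.1 h2]
  · have hd : 0 < dist x y := dist_pos.2 hxy
    have hst := CATZero.stewart x z y z' h
    have e1 : dist z y = dist x y - dist x z := by linarith
    have e2 : dist y z' = dist x y - dist x z := by rw [dist_comm]; linarith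
    rw [e1, e2, ← hz] at hst
    have : dist x y * dist z z' ^ 2 ≤ 0 := by nlinarith
    have h0 : dist z z' ^ 2 ≤ 0 := by
      by_contra hc
      push Not at hc
      nlinarith [mul_pos hd hc]
    have : dist z z' = 0 := by
      have := sq_nonneg (dist z z')
      exact pow_eq_zero_iff (two_ne_zero) |>.1 (le_antisymm h0 this)
    exact dist_eq_zero.1 this

lemma eq_geo {x y z : X} {t : ℝ} (h : dist x z + dist z y = dist x y)
    (hz : dist x z = clamp t * dist x y) : z = geo x y t :=
  eq_of_between h (dist_geo_add x y t) (by rw [hz, dist_left_geo])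

lemma geo_zero (x y : X) : geo x y 0 = x := by
  symm; apply eq_geo <;> simp [clamp]

lemma geo_one (x y : X) : geo x y 1 = y := by
  symm; apply eq_geo <;> simp [clamp]

lemma geo_self (x : X) (t : ℝ) : geo x x t = x := by
  symm; apply eq_geo <;> simp

lemma exists_geo_eq {x y z : X} (h : dist x z + dist z y = dist x y) :
    ∃ t ∈ Icc (0 : ℝ) 1, z = geo x y t := by
  rcases eq_or_ne x y with rfl | hxy
  · refine ⟨0, by simp, ?_⟩
    rw [dist_self, dist_comm z] at h
    have h1 : dist x z = 0 := by linarith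
    rw [geo_self, dist_eq_zero.1 h1]
  · have hd : 0 < dist x y := dist_pos.2 hxy
    have hm : dist x z / dist x y ∈ Icc (0 : ℝ) 1 :=
      ⟨by positivity, by rw [div_le_one hd]; linarith [dist_nonneg (x := z) (y := y)]⟩
    refine ⟨dist x z / dist x y, hm, eq_geo h ?_⟩
    rw [clamp_of_mem hm]; field_simp

lemma clamp_one_sub (t : ℝ) : clamp (1 - t) = 1 - clamp t := by
  unfold clamp
  rcases le_total 1 t with h | h
  · rw [min_eq_left h, max_eq_right zero_le_one, min_eq_right (by linarith), max_eq_left] <;>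
      linarith
  · rcases le_total 0 t with h' | h'
    · rw [min_eq_right h, max_eq_right h', min_eq_right (by linarith), max_eq_right] <;> linarith
    · rw [min_eq_right h, max_eq_left h', min_eq_left (by linarith), max_eq_right] <;> linarith

lemma geo_symm (x y : X) (t : ℝ) : geo x y t = geo y x (1 - t) := by
  apply eq_geo
  · rw [dist_comm y, dist_comm _ x, add_comm, dist_geo_add, dist_comm]
  · rw [dist_comm, dist_geo_right, clamp_one_sub, dist_comm x]

lemma dist_geo_sq_le (x y w : X) (t : ℝ) :
    dist (geo x y t) w ^ 2 ≤ (1 - clamp t) * dist x w ^ 2 + clamp t * dist y w ^ 2 -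
      clamp t * (1 - clamp t) * dist x y ^ 2 := by
  rcases eq_or_ne x y with rfl | hxy
  · rw [geo_self]; simp
    linarith
  · have hd : 0 < dist x y := dist_pos.2 hxy
    have := CATZero.stewart x (geo x y t) y w (dist_geo_add x y t)
    rw [dist_left_geo, dist_geo_right] at this
    refine le_of_mul_le_mul_left (this.trans (le_of_eq ?_)) hd
    ring

lemma dist_geo_geo_same_left (x y y' : X) (t : ℝ) :
    dist (geo x y t) (geo x y' t) ≤ clamp t * dist y y' := by
  obtain ⟨h0, h1⟩ := clamp_mem t
  have e1 := dist_geo_sq_le x y (geo x y' t) t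
  have e2 := dist_geo_sq_le x y' y t
  rw [dist_left_geo, dist_comm y] at e1
  rw [dist_comm y' y] at e2
  have : dist (geo x y t) (geo x y' t) ^ 2 ≤ (clamp t * dist y y') ^ 2 := by
    nlinarith [mul_le_mul_of_nonneg_left e2 h0]
  exact abs_le_of_sq_le_sq' this (by positivity) |>.2

lemma dist_geo_geo_same_ends (x y : X) (s t : ℝ) :
    dist (geo x y s) (geo x y t) = |clamp s - clamp t| * dist x y := by
  wlog h : clamp s ≤ clamp t generalizing s t
  · rw [dist_comm, this t s (not_le.1 h).le, abs_sub_comm]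
  obtain ⟨hs0, hs1⟩ := clamp_mem s
  obtain ⟨ht0, ht1⟩ := clamp_mem t
  rcases eq_or_lt_of_le ht0 with h0 | h0
  · have hs : clamp s = 0 := by linarith
    have : geo x y s = geo x y t := eq_geo (dist_geo_add _ _ _) (by rw [dist_left_geo, hs, ← h0])
    rw [this, hs, ← h0]; simp
  have hm : clamp s / clamp t ∈ Icc (0 : ℝ) 1 := ⟨by positivity, by rw [div_le_one h0]; exact h⟩
  have hsz : geo x (geo x y t) (clamp s / clamp t) = geo x y s := by
    have e1 : dist x (geo x (geo x y t) (clamp s / clamp t)) = clamp s * dist x y := by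
      rw [dist_left_geo, dist_left_geo, clamp_of_mem hm]; field_simp
    apply eq_geo _ e1
    have e2 := dist_geo_add x (geo x y t) (clamp s / clamp t)
    have e3 := dist_triangle (geo x (geo x y t) (clamp s / clamp t)) (geo x y t) y
    have e4 := dist_geo_add x y t
    have e5 := dist_triangle x (geo x (geo x y t) (clamp s / clamp t)) y
    linarith
  rw [← hsz, dist_geo_right, dist_left_geo, clamp_of_mem hm, abs_sub_comm,
    abs_of_nonneg (by linarith)]
  field_simp

lemma dist_geo_geo_le (x y x' y' : X) (t t' : ℝ) : dist (geo x y t) (geo x' y' t') ≤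
    |clamp t - clamp t'| * dist x y + dist y y' + dist x x' := by
  have h1 := dist_geo_geo_same_ends x y t t'
  have h2 : dist (geo x y t') (geo x y' t') ≤ dist y y' :=
    (dist_geo_geo_same_left x y y' t').trans
      (mul_le_of_le_one_left dist_nonneg (clamp_mem t').2)
  have h3 : dist (geo x y' t') (geo x' y' t') ≤ dist x x' := by
    rw [geo_symm x, geo_symm x']
    exact (dist_geo_geo_same_left _ _ _ _).trans
      (mul_le_of_le_one_left dist_nonneg (clamp_mem _).2)
  have := dist_triangle4 (geo x y t) (geo x y t') (geo x y' t') (geo x' y' t')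
  linarith

lemma continuous_geo : Continuous fun p : X × X × ℝ => geo p.1 p.2.1 p.2.2 := by
  rw [continuous_iff_continuousAt]
  rintro ⟨x, y, t⟩
  rw [ContinuousAt, tendsto_iff_dist_tendsto_zero]
  have hc : Continuous fun p : X × X × ℝ =>
      |clamp t - clamp p.2.2| * dist x y + dist y p.2.1 + dist x p.1 := by fun_prop
  have := hc.tendsto (x, y, t)
  simp only [sub_self, abs_zero, zero_mul, dist_self, add_zero] at this
  refine squeeze_zero (fun _ => dist_nonneg) (fun p => ?_) this
  rw [dist_comm]
  exact dist_geo_geo_le _ _ _ _ _ _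

@[fun_prop]
lemma Continuous.geo' {Y : Type*} [TopologicalSpace Y] {f g : Y → X} {h : Y → ℝ}
    (hf : Continuous f) (hg : Continuous g) (hh : Continuous h) :
    Continuous fun a => geo (f a) (g a) (h a) :=
  continuous_geo.comp (hf.prodMk (hg.prodMk hh))

lemma dist_geo_lt {x y c : X} {r : ℝ} (hx : dist x c < r) (hy : dist y c < r) (t : ℝ) :
    dist (geo x y t) c < r := by
  obtain ⟨h0, h1⟩ := clamp_mem t
  have := dist_geo_sq_le x y c t
  have hr : 0 < r := dist_nonneg.trans_lt hx
  have hx2 : dist x c ^ 2 < r ^ 2 := by gcongr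
  have hy2 : dist y c ^ 2 < r ^ 2 := by gcongr
  have h3 : 0 ≤ clamp t * (1 - clamp t) * dist x y ^ 2 :=
    mul_nonneg (mul_nonneg h0 (by linarith)) (sq_nonneg _)
  have h4 : (1 - clamp t) * dist x c ^ 2 + clamp t * dist y c ^ 2 < r ^ 2 := by
    rcases eq_or_lt_of_le h0 with h | h
    · rw [← h]; simpa using hx2
    · nlinarith [mul_lt_mul_of_pos_left hy2 h,
        mul_le_mul_of_nonneg_left hx2.le (sub_nonneg.2 h1)]
  exact lt_of_pow_lt_pow_left₀ 2 hr.le (by linarith)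

lemma geo_mem_ball {x y c : X} {r : ℝ} (hx : x ∈ ball c r) (hy : y ∈ ball c r) (t : ℝ) :
    geo x y t ∈ ball c r := dist_geo_lt hx hy t

lemma between_of_between {q w y y' : X} (hw : dist q w + dist w y' = dist q y')
    (hy : dist q y + dist y y' = dist q y') (h : dist q w ≤ dist q y) :
    dist q w + dist w y = dist q y := by
  rcases eq_or_ne q y with rfl | hne
  · rw [dist_self] at h
    have : dist q w = 0 := le_antisymm h dist_nonneg
    rw [dist_eq_zero.1 this]; simp
  have hd : 0 < dist q y := dist_pos.2 hne
  have hm : dist q w / dist q y ∈ Icc (0 : ℝ) 1 :=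
    ⟨by positivity, by rw [div_le_one hd]; exact h⟩
  have e1 : dist q (geo q y (dist q w / dist q y)) = dist q w := by
    rw [dist_left_geo, clamp_of_mem hm]; field_simp
  have e2 := dist_geo_add q y (dist q w / dist q y)
  have e3 := dist_triangle (geo q y (dist q w / dist q y)) y y'
  have e5 := dist_triangle q (geo q y (dist q w / dist q y)) y'
  have : geo q y (dist q w / dist q y) = w := by
    refine eq_of_between (x := q) (y := y') ?_ hw e1
    linarith
  rw [← this]; exact e2

lemma not_equidistant_of_between {a b c y : X} {r : ℝ} (hab : a ≠ b) (hbc : b ≠ c)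
    (h : dist a b + dist b c = dist a c) (ha : dist a y = r) (hb : dist b y = r)
    (hc : dist c y = r) : False := by
  have h1 := dist_pos.2 hab
  have h2 := dist_pos.2 hbc
  have := CATZero.stewart a b c y h
  rw [ha, hb, hc, ← h] at this
  nlinarith [mul_pos (mul_pos h1 h2) (add_pos h1 h2)]

end Geo

lemma mem_geodSeg_iff {κ : ℝ} {X : Type*} [MetricSpace X] [CATZero X]
    (hX : IsCATSpace κ X) (x y w : X) :
    w ∈ geodSeg (xDist X) univ x y ↔ dist x w + dist w y = dist x y := by
  constructor
  · intro h
    simp only [geodSeg, mem_iUnion, mem_ofPred_eq] at h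
    obtain ⟨f, hf, t, ht, rfl⟩ := h
    rw [hf.dist_left ht.1 ht.2, hf.dist_right ht.1 ht.2]
    ring
  · intro h
    obtain ⟨f, hf⟩ := hX.1 x (mem_univ _) y (mem_univ _)
    simp only [geodSeg, mem_iUnion, mem_ofPred_eq]
    have hm : dist x w ∈ Icc 0 (dist x y) :=
      ⟨dist_nonneg, by linarith [dist_nonneg (x := w) (y := y)]⟩
    refine ⟨f, hf, dist x w, hm, ?_⟩
    refine eq_of_between (x := x) (y := y) ?_ h (hf.dist_left hm.1 hm.2)
    rw [hf.dist_left hm.1 hm.2, hf.dist_right hm.1 hm.2]; ring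

section Cocycle
open Topology
variable {X : Type*} {A : Type*} [AddCommGroup A]

/-- `F` is a primitive of the cocycle `φ` along the map `g`. -/
def IsPrim {Y : Type*} [TopologicalSpace Y] (φ : X → X → A) (g : Y → X) (F : Y → A) : Prop :=
  ∀ y, ∀ᶠ y' in 𝓝 y, F y' - F y = φ (g y) (g y')

variable {φ : X → X → A}

lemma IsPrim.comp {Y Y' : Type*} [TopologicalSpace Y] [TopologicalSpace Y'] {g : Y → X}
    {F : Y → A} (h : IsPrim φ g F) {k : Y' → Y} (hk : Continuous k) :
    IsPrim φ (g ∘ k) (F ∘ k) := fun y => (hk.tendsto y).eventually (h (k y))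

lemma IsPrim.sub_eq_sub {Y : Type*} [TopologicalSpace Y] [PreconnectedSpace Y] {g : Y → X}
    {F F' : Y → A} (h : IsPrim φ g F) (h' : IsPrim φ g F') (y y' : Y) :
    F y' - F y = F' y' - F' y := by
  have : IsLocallyConstant fun y => F y - F' y := by
    rw [IsLocallyConstant.iff_eventually_eq]
    intro y
    filter_upwards [h y, h' y] with z hz hz'
    rw [← hz'] at hz
    rw [sub_eq_sub_iff_sub_eq_sub]; exact hz
  have := this.apply_eq_of_preconnectedSpace y' y
  rwa [sub_eq_sub_iff_sub_eq_sub] at this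

lemma IsPrim.sub_eq_of_isPreconnected {Y : Type*} [TopologicalSpace Y] {g : Y → X}
    {F : Y → A} (h : IsPrim φ g F) {U : Set X}
    (hU : ∀ x ∈ U, ∀ y ∈ U, ∀ z ∈ U, φ x y + φ y z = φ x z) {J : Set Y}
    (hJ : IsPreconnected J) (hg : MapsTo g J U) {s t : Y} (hs : s ∈ J) (ht : t ∈ J) :
    F t - F s = φ (g s) (g t) := by
  refine hJ.induction₂' (fun s t => F t - F s = φ (g s) (g t)) ?_ ?_ hs ht
  · intro x hx
    filter_upwards [nhdsWithin_le_nhds (h x), self_mem_nhdsWithin] with y hy hyJ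
    refine ⟨hy, ?_⟩
    have h1 := hU _ (hg hx) _ (hg hx) _ (hg hx)
    have h2 := hU _ (hg hx) _ (hg hyJ) _ (hg hx)
    have h3 : φ (g x) (g x) = 0 := by simpa using h1
    rw [h3, ← hy] at h2
    rw [← neg_sub, neg_eq_iff_add_eq_zero, h2]
  · intro x y z hx hy hz h1 h2
    rw [← hU _ (hg hx) _ (hg hy) _ (hg hz), ← h1, ← h2]; abel

variable [TopologicalSpace X]

/-- `φ` is a one-cocycle (in the Alexander–Spanier sense) on `B`: it is additive near every
point of `B`. -/
def IsCocycleOn (φ : X → X → A) (B : Set X) : Prop :=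
  ∀ b ∈ B, ∃ U ∈ 𝓝 b, ∀ x ∈ U, ∀ y ∈ U, ∀ z ∈ U, φ x y + φ y z = φ x z

variable {B : Set X}

lemma IsCocycleOn.mono {B' : Set X} (h : IsCocycleOn φ B) (hB : B' ⊆ B) : IsCocycleOn φ B' :=
  fun b hb => h b (hB hb)

lemma IsCocycleOn.self (h : IsCocycleOn φ B) {b : X} (hb : b ∈ B) : φ b b = 0 := by
  obtain ⟨U, hU, hφ⟩ := h b hb
  have hm := mem_of_mem_nhds hU
  simpa using hφ b hm b hm b hm

lemma exists_isPrim_min (hφ : IsCocycleOn φ B) {c : ℝ → X} (hc : Continuous c)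
    (hB : ∀ t, c t ∈ B) {T₀ : ℝ} (h₀ : ∀ t ≤ T₀, c t = c T₀) (T : ℝ) :
    ∃ F : ℝ → A, IsPrim φ (fun t => c (min t T)) F := by
  have key : IsLocallyConstant fun T : ℝ => ∃ F : ℝ → A, IsPrim φ (fun t => c (min t T)) F := by
    rw [IsLocallyConstant.iff_eventually_eq]
    intro T₁
    obtain ⟨U, hU, hUφ⟩ := hφ _ (hB T₁)
    obtain ⟨r, hr, hrU⟩ := Metric.mem_nhds_iff.1 (hc.continuousAt hU)
    have step : ∀ T ∈ ball T₁ r, ∀ T' ∈ ball T₁ r,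
        (∃ F : ℝ → A, IsPrim φ (fun t => c (min t T)) F) →
        ∃ F : ℝ → A, IsPrim φ (fun t => c (min t T')) F := by
      rintro T hT T' hT' ⟨F, hF⟩
      rcases le_total T' T with hle | hle
      · refine ⟨fun t => F (min t T'), ?_⟩
        have := hF.comp (k := fun t => min t T') (by fun_prop)
        have e : (fun t => c (min t T)) ∘ (fun t => min t T') = fun t => c (min t T') := by
          ext t
          simp [hle]
        rwa [e] at this
      · refine ⟨fun t => F t + φ (c (min t T)) (c (min t T')), fun t => ?_⟩
        rcases lt_or_ge t T with ht | ht
        · filter_upwards [hF t, Iio_mem_nhds ht] with t' h1 h2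
          simp only [mem_Iio] at h2
          rw [min_eq_left ht.le, min_eq_left h2.le] at *
          rw [min_eq_left (ht.le.trans hle), min_eq_left (h2.le.trans hle)]
          rw [hφ.self (hB _), hφ.self (hB _)]
          simpa using h1
        · have hcont : ∀ S ∈ ball T₁ r, S ≤ T' → T ≤ S →  ∀ᶠ t' in 𝓝 t, min t' S ∈ ball T₁ r := by
            intro S hS _ h2
            have : min t S ∈ ball T₁ r := by
              rw [Real.ball_eq_Ioo] at *
              exact ⟨lt_min (hT.1.trans_le ht) hS.1, (min_le_right _ _).trans_lt hS.2⟩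
            exact (Continuous.tendsto (by fun_prop : Continuous fun t' => min t' S) t).eventually
              (isOpen_ball.mem_nhds this)
          have h1 := hcont T hT hle le_rfl
          have h2 := hcont T' hT' le_rfl hle
          filter_upwards [hF t, h1, h2] with t' e1 e2 e3
          have m1 := hrU h1.self_of_nhds
          have m2 := hrU h2.self_of_nhds
          have m3 := hrU e2
          have m4 := hrU e3
          have q1 := hUφ _ m1 _ m3 _ m4
          have q2 := hUφ _ m1 _ m2 _ m4
          rw [add_sub_add_comm, e1, ← add_sub_assoc, q1, ← q2]; abel
    filter_upwards [ball_mem_nhds T₁ hr] with T hT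
    exact propext ⟨step T hT T₁ (mem_ball_self hr), step T₁ (mem_ball_self hr) T hT⟩
  have := key.apply_eq_of_preconnectedSpace T T₀
  rw [this]
  refine ⟨0, fun t => Eventually.of_forall fun t' => ?_⟩
  simp [h₀ _ (min_le_right _ _), hφ.self (hB _)]

/-- A continuous path in `B`, parametrized by `[0,1]` and extended by constants. -/
structure IsPathOn (B : Set X) (c : ℝ → X) : Prop where
  cont : Continuous c
  clamp : ∀ t, c (clamp t) = c t
  mem : ∀ t, c t ∈ B

lemma clamp_of_nonpos {t : ℝ} (h : t ≤ 0) : clamp t = 0 := by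
  simp [Cat2Cx.clamp, h]

lemma clamp_min_one (t : ℝ) : clamp (min t 1) = clamp t := by
  simp [Cat2Cx.clamp, min_comm t 1]

lemma clamp_clamp (t : ℝ) : Cat2Cx.clamp (Cat2Cx.clamp t) = Cat2Cx.clamp t :=
  clamp_of_mem (clamp_mem t)

lemma geo_clamp {X : Type*} [MetricSpace X] [CATZero X] (x y : X) (t : ℝ) :
    geo x y (Cat2Cx.clamp t) = geo x y t := by
  simp [geo, clamp_clamp]

lemma IsCocycleOn.exists_isPrim (hφ : IsCocycleOn φ B) {c : ℝ → X} (hc : IsPathOn B c) :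
    ∃ F : ℝ → A, IsPrim φ c F := by
  obtain ⟨F, hF⟩ := exists_isPrim_min hφ hc.cont hc.mem (T₀ := 0)
    (fun t ht => by rw [← hc.clamp t, clamp_of_nonpos ht]) 1
  refine ⟨F, ?_⟩
  convert hF using 1
  ext t
  rw [← hc.clamp t, ← hc.clamp (min t 1), clamp_min_one]

open Classical in
/-- The integral of the cocycle `φ` along the path `c`. -/
noncomputable def pint (φ : X → X → A) (c : ℝ → X) : A :=
  if h : ∃ F : ℝ → A, IsPrim φ c F then h.choose 1 - h.choose 0 else 0

lemma IsPrim.pint_eq {c : ℝ → X} {F : ℝ → A} (h : IsPrim φ c F) : pint φ c = F 1 - F 0 := by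
  have hex : ∃ F : ℝ → A, IsPrim φ c F := ⟨F, h⟩
  rw [pint, dif_pos hex]
  exact hex.choose_spec.sub_eq_sub h 0 1

lemma pint_variation (hφ : IsCocycleOn φ B) {Y : Type*} [TopologicalSpace Y] {H : Y → ℝ → X}
    (hH : Continuous fun p : Y × ℝ => H p.1 p.2) (hp : ∀ y, IsPathOn B (H y)) (y : Y) :
    ∀ᶠ y' in 𝓝 y, pint φ (H y') - pint φ (H y) =
      φ (H y 1) (H y' 1) - φ (H y 0) (H y' 0) := by
  choose F hF using fun y => hφ.exists_isPrim (hp y)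
  have key : IsLocallyConstant fun t : ℝ => ∀ᶠ y' in 𝓝 y,
      F y' t - F y t - φ (H y t) (H y' t) = F y' 0 - F y 0 - φ (H y 0) (H y' 0) := by
    rw [IsLocallyConstant.iff_eventually_eq]
    intro t₀
    obtain ⟨U, hU, hUφ⟩ := hφ _ ((hp y).mem t₀)
    have hpre := hH.continuousAt (x := (y, t₀)) hU
    rw [mem_map, nhds_prod_eq, mem_prod_iff] at hpre
    obtain ⟨N, hN, J, hJ, hNJ⟩ := hpre
    obtain ⟨r, hr, hrJ⟩ := Metric.mem_nhds_iff.1 hJ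
    have hmem : ∀ y' ∈ N, ∀ t ∈ ball t₀ r, H y' t ∈ U := fun y' hy' t ht =>
      hNJ (show (y', t) ∈ N ×ˢ J from ⟨hy', hrJ ht⟩)
    have hyN := mem_of_mem_nhds hN
    have hpc : IsPreconnected (ball t₀ r) := by
      rw [Real.ball_eq_Ioo]; exact isPreconnected_Ioo
    have step : ∀ t ∈ ball t₀ r, ∀ t' ∈ ball t₀ r, (∀ᶠ y' in 𝓝 y,
      F y' t - F y t - φ (H y t) (H y' t) = F y' 0 - F y 0 - φ (H y 0) (H y' 0)) →
      ∀ᶠ y' in 𝓝 y,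
      F y' t' - F y t' - φ (H y t') (H y' t') = F y' 0 - F y 0 - φ (H y 0) (H y' 0) := by
      intro t ht t' ht' h
      filter_upwards [h, hN] with y' hy' hy'N
      rw [← hy']
      have e1 := (hF y').sub_eq_of_isPreconnected hUφ hpc (hmem y' hy'N) ht ht'
      have e2 := (hF y).sub_eq_of_isPreconnected hUφ hpc (hmem y hyN) ht ht'
      have q1 := hUφ _ (hmem y hyN t ht) _ (hmem y hyN t' ht') _ (hmem y' hy'N t' ht')
      have q2 := hUφ _ (hmem y hyN t ht) _ (hmem y' hy'N t ht) _ (hmem y' hy'N t' ht')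
      rw [← e2] at q1
      rw [← e1, ← q1] at q2
      have q3 : φ (H y t) (H y' t) = F y t' - F y t + φ (H y t') (H y' t') -
        (F y' t' - F y' t) := by rw [← q2]; abel
      rw [q3]; abel
    filter_upwards [ball_mem_nhds t₀ hr] with t ht
    exact propext ⟨step t ht t₀ (mem_ball_self hr), step t₀ (mem_ball_self hr) t ht⟩
  have h1 := key.apply_eq_of_preconnectedSpace 1 0
  simp only [eventually_true, eq_iff_iff, iff_true] at h1
  filter_upwards [h1] with y' hy'
  rw [(hF y').pint_eq, (hF y).pint_eq]
  rw [sub_eq_iff_eq_add] at hy'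
  rw [sub_sub_sub_comm, hy']; abel

lemma pint_homotopy (hφ : IsCocycleOn φ B) {Y : Type*} [TopologicalSpace Y] [PreconnectedSpace Y]
    {H : Y → ℝ → X} (hH : Continuous fun p : Y × ℝ => H p.1 p.2) (hp : ∀ y, IsPathOn B (H y))
    (hends : ∀ y y', φ (H y 1) (H y' 1) = φ (H y 0) (H y' 0)) (y y' : Y) :
    pint φ (H y) = pint φ (H y') := by
  have : IsLocallyConstant fun y => pint φ (H y) := by
    rw [IsLocallyConstant.iff_eventually_eq]
    intro y
    filter_upwards [pint_variation hφ hH hp y] with y' hy'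
    rw [hends, sub_self, sub_eq_zero] at hy'
    exact hy'
  exact this.apply_eq_of_preconnectedSpace _ _

/-- `χ` is a primitive of the cocycle `φ` on the open set `W`. -/
def IsPrimOn (φ : X → X → A) (W : Set X) (χ : X → A) : Prop :=
  ∀ x ∈ W, ∀ᶠ x' in 𝓝 x, χ x' - χ x = φ x x'

lemma IsPrimOn.isPrim {W : Set X} {χ : X → A} (h : IsPrimOn φ W χ) {c : ℝ → X}
    (hc : IsPathOn W c) : IsPrim φ c (χ ∘ c) :=
  fun t => (hc.cont.tendsto t).eventually (h _ (hc.mem t))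

lemma IsPrimOn.pint_eq {W : Set X} {χ : X → A} (h : IsPrimOn φ W χ) {c : ℝ → X}
    (hc : IsPathOn W c) : pint φ c = χ (c 1) - χ (c 0) := (h.isPrim hc).pint_eq

end Cocycle

section CocycleGeo
open Topology
variable {X : Type*} [MetricSpace X] [CATZero X] {A : Type*} [AddCommGroup A]
  {φ : X → X → A}

lemma isPathOn_geo {B : Set X} {x y : X} (h : ∀ t, geo x y t ∈ B) : IsPathOn B (geo x y) :=
  ⟨by fun_prop, geo_clamp x y, h⟩

lemma IsCocycleOn.exists_isPrimOn {W : Set X} (hφ : IsCocycleOn φ W) (hW : IsOpen W) {o : X}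
    (hstar : ∀ x ∈ W, ∀ t, geo o x t ∈ W) : ∃ χ : X → A, IsPrimOn φ W χ := by
  refine ⟨fun x => pint φ (geo o x), fun x hx => ?_⟩
  have hv := pint_variation (Y := W) hφ (H := fun w t => geo o w t) (by fun_prop)
    (fun w => isPathOn_geo (hstar w w.2)) ⟨x, hx⟩
  have ho : o ∈ W := by simpa [geo_zero] using hstar x hx 0
  rw [nhds_subtype_eq_comap, eventually_comap] at hv
  filter_upwards [hv, hW.mem_nhds hx] with x' h1 h2
  have := h1 ⟨x', h2⟩ rfl
  simpa [geo_one, geo_zero, hφ.self ho] using this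

lemma IsCocycleOn.exists_isPrimOn_ball {o : X} {r : ℝ} (hφ : IsCocycleOn φ (ball o r)) :
    ∃ χ : X → A, IsPrimOn φ (ball o r) χ := by
  refine hφ.exists_isPrimOn isOpen_ball (o := o) fun x hx t => geo_mem_ball ?_ hx t
  rw [mem_ball] at *
  rw [dist_self]; exact dist_nonneg.trans_lt hx

lemma IsPrimOn.pint_geo_eq {o : X} {r : ℝ} {χ : X → A} (h : IsPrimOn φ (ball o r) χ) {x x' : X}
    (hx : x ∈ ball o r) (hx' : x' ∈ ball o r) : pint φ (geo x x') = χ x' - χ x := by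
  rw [h.pint_eq (isPathOn_geo fun t => geo_mem_ball hx hx' t), geo_one, geo_zero]

end CocycleGeo

section Homology
open Topology unitInterval

section Forward
variable {Y : Type*} [TopologicalSpace Y] {A : Type*} [AddCommGroup A] {φ : Y → Y → A}

lemma isPathOn_extend {x y : Y} (p : Path x y) : IsPathOn univ p.extend where
  cont := p.continuous_extend
  clamp t := congrArg p (Subtype.ext (clamp_clamp t))
  mem _ := mem_univ _

lemma pint_eq_of_homotopic (hφ : IsCocycleOn φ univ) {x y : Y} {p q : Path x y}
    (h : p.Homotopic q) : pint φ p.extend = pint φ q.extend := by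
  obtain ⟨F⟩ := h
  have := pint_homotopy hφ (Y := I) (H := fun s => (F.eval s).extend) (by
      have : Continuous fun a : I × ℝ => F (a.1, projIcc 0 1 zero_le_one a.2) := by fun_prop
      exact this) (fun s => isPathOn_extend _)
      (by intro s s'; simp [hφ.self (mem_univ _)]) 0 1
  simpa using this

lemma pint_trans (hφ : IsCocycleOn φ univ) {x y z : Y} (p : Path x y) (q : Path y z) :
    pint φ (p.trans q).extend = pint φ p.extend + pint φ q.extend := by
  obtain ⟨G, hG⟩ := hφ.exists_isPrim (isPathOn_extend (p.trans q))
  have h1 : IsPrim φ p.extend (G ∘ fun t => clamp t / 2) := by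
    have := hG.comp (k := fun t => clamp t / 2) (by fun_prop)
    have e : (p.trans q).extend ∘ (fun t => clamp t / 2) = p.extend := by
      ext t
      obtain ⟨h0, h1⟩ := clamp_mem t
      have hm : clamp t / 2 ∈ I := ⟨by positivity, by linarith⟩
      rw [← (isPathOn_extend p).clamp t]
      simp only [Function.comp]
      rw [Path.extend_apply _ hm, Path.extend_apply _ ⟨h0, h1⟩, Path.trans_apply]
      rw [dif_pos (by simp only; linarith)]
      congr 1
      apply Subtype.ext
      simp only
      ring
    rwa [e] at this
  have h2 : IsPrim φ q.extend (G ∘ fun t => (1 + clamp t) / 2) := by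
    have := hG.comp (k := fun t => (1 + clamp t) / 2) (by fun_prop)
    have e : (p.trans q).extend ∘ (fun t => (1 + clamp t) / 2) = q.extend := by
      ext t
      obtain ⟨h0, h1⟩ := clamp_mem t
      have hm : (1 + clamp t) / 2 ∈ I := ⟨by positivity, by linarith⟩
      rw [← (isPathOn_extend q).clamp t]
      simp only [Function.comp]
      rw [Path.extend_apply _ hm, Path.extend_apply _ ⟨h0, h1⟩, Path.trans_apply]
      split_ifs with h
      · have h3 : clamp t = 0 := by simp only at h; linarith
        simp [h3]
      · congr 1
        apply Subtype.ext
        simp only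
        ring
    rwa [e] at this
  rw [hG.pint_eq, h1.pint_eq, h2.pint_eq]
  have e0 : clamp 0 = 0 := clamp_of_mem (by simp)
  have e1 : clamp 1 = 1 := clamp_of_mem (by simp)
  simp only [Function.comp, e0, e1]
  norm_num

/-- Integration of a cocycle over loops. -/
noncomputable def periodHom (hφ : IsCocycleOn φ univ) (x : Y) :
    FundamentalGroup Y x →* Multiplicative A :=
  MonoidHom.mk' (fun g => Multiplicative.ofAdd
    (Quotient.lift (fun p : Path x x => pint φ p.extend)
      (fun _ _ h => pint_eq_of_homotopic hφ h) g)) (by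
    intro g h
    induction g using Quotient.inductionOn with | _ p
    induction h using Quotient.inductionOn with | _ q
    rw [mul_comm]
    exact congrArg Multiplicative.ofAdd (pint_trans hφ q p))

lemma pint_eq_zero_of_loopClassH1_eq_one (hφ : IsCocycleOn φ univ) {x : Y} (p : Path x x)
    (h : loopClassH1 p = 1) : pint φ p.extend = 0 := by
  have := congrArg (Abelianization.lift (periodHom hφ x)) h
  rw [map_one] at this
  exact congrArg Multiplicative.toAdd this

end Forward

/-- The parametrization of a simple closed curve extended by constants. -/
noncomputable def SCC.crv {X : Type*} [TopologicalSpace X] (γ : SCC X) (t : ℝ) : X :=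
  γ.toFun (clamp t)

lemma SCC.isPathOn_crv {X : Type*} [TopologicalSpace X] (γ : SCC X) {B : Set X}
    (h : γ.img ⊆ B) : IsPathOn B γ.crv where
  cont := γ.contOn.comp_continuous continuous_clamp clamp_mem
  clamp t := congrArg γ.toFun (clamp_clamp t)
  mem t := h ⟨_, clamp_mem t, rfl⟩

lemma SCC.crv_zero_eq_crv_one {X : Type*} [TopologicalSpace X] (γ : SCC X) :
    γ.crv 0 = γ.crv 1 := by
  have e0 : Cat2Cx.clamp 0 = 0 := clamp_of_mem (by simp)
  have e1 : Cat2Cx.clamp 1 = 1 := clamp_of_mem (by simp)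
  simp only [SCC.crv, e0, e1, γ.loop]

lemma SCC.range_crv {X : Type*} [TopologicalSpace X] (γ : SCC X) : range γ.crv = γ.img := by
  ext x
  constructor
  · rintro ⟨t, rfl⟩; exact ⟨_, clamp_mem t, rfl⟩
  · rintro ⟨t, ht, rfl⟩; exact ⟨t, by rw [SCC.crv, clamp_of_mem ht]⟩

lemma SCC.isCompact_img {X : Type*} [TopologicalSpace X] (γ : SCC X) : IsCompact γ.img :=
  isCompact_Icc.image_of_continuousOn γ.contOn

lemma SCC.pint_eq_zero {X : Type*} [TopologicalSpace X] {A : Type*} [AddCommGroup A] (γ : SCC X)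
    {B : Set X} (hB : γ.img ⊆ B) (h : γ.NullhomologousIn B) {φ : X → X → A}
    (hφ : IsCocycleOn φ B) : pint φ γ.crv = 0 := by
  have hφ' : IsCocycleOn (fun b b' : B => φ b b') univ := by
    intro b _
    obtain ⟨U, hU, hUφ⟩ := hφ b b.2
    exact ⟨_, continuous_subtype_val.continuousAt hU, fun x hx y hy z hz => hUφ x hx y hy z hz⟩
  exact pint_eq_zero_of_loopClassH1_eq_one hφ' (γ.pathIn B hB) (h hB)

lemma SCC.mem_interiorSet_of_pint_ne_zero {X : Type*} [TopologicalSpace X] {A : Type*}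
    [AddCommGroup A] (γ : SCC X) {z : X} (hz : z ∉ γ.img) {φ : X → X → A}
    (hφ : IsCocycleOn φ {z}ᶜ) (h : pint φ γ.crv ≠ 0) : z ∈ γ.interiorSet :=
  ⟨hz, fun hn => h (γ.pint_eq_zero (fun x hx (hxz : x = z) => hz (hxz ▸ hx)) hn hφ)⟩

section Detection

open Classical in
lemma exists_groupoid_character {Y : Type*} [TopologicalSpace Y] {x : Y} {p : Path x x}
    (hp : loopClassH1 p ≠ 1) :
    ∃ K : ∀ u v : Y, Path.Homotopic.Quotient u v → AddCircle (1 : ℚ),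
      (∀ u v w (q : Path.Homotopic.Quotient u v) (q' : Path.Homotopic.Quotient v w),
        K u w (q.trans q') = K u v q + K v w q') ∧ K x x (.mk p) ≠ 0 := by
  obtain ⟨c, hc⟩ := CharacterModule.exists_character_apply_ne_zero_of_ne_zero
    (A := Additive (Abelianization (FundamentalGroup Y x))) (a := Additive.ofMul (loopClassH1 p))
    (fun h => hp (congrArg Additive.toMul h))
  let cl : Path.Homotopic.Quotient x x → AddCircle (1 : ℚ) := fun l =>
    c (Additive.ofMul (Abelianization.of (FundamentalGroup.fromPath l)))
  have cl_trans : ∀ l l', cl (l.trans l') = cl l + cl l' := by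
    intro l l'
    have : FundamentalGroup.fromPath (l.trans l') =
      FundamentalGroup.fromPath l' * FundamentalGroup.fromPath l := rfl
    simp only [cl]
    rw [this, map_mul, ofMul_mul, map_add, add_comm]
  let P : ∀ v : Y, Joined x v → Path.Homotopic.Quotient x v := fun v h => .mk h.somePath
  refine ⟨fun u v q => if h : Joined x u ∧ Joined x v then
    cl (((P u h.1).trans q).trans (P v h.2).symm) else 0, ?_, ?_⟩
  · intro u v w q q'
    obtain ⟨q₀, rfl⟩ := Path.Homotopic.Quotient.mk_surjective q
    obtain ⟨q₁, rfl⟩ := Path.Homotopic.Quotient.mk_surjective q'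
    have juv : Joined u v := ⟨q₀⟩
    have jvw : Joined v w := ⟨q₁⟩
    by_cases hu : Joined x u
    · have hv := hu.trans juv
      have hw := hv.trans jvw
      simp only [hu, hv, hw, and_self, dif_pos]
      rw [← cl_trans]
      congr 1
      simp only [Path.Homotopic.Quotient.trans_assoc]
      rw [← Path.Homotopic.Quotient.trans_assoc (P v hv).symm,
        Path.Homotopic.Quotient.symm_trans, Path.Homotopic.Quotient.refl_trans]
    · have hv : ¬ Joined x v := fun h => hu (h.trans juv.symm)
      simp [hu, hv]
  · have hx : Joined x x := Joined.refl x
    simp only [hx, and_self, dif_pos]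
    have h0 : cl (P x hx) + cl (P x hx).symm = 0 := by
      have h1 : cl (.refl x) = 0 := by
        have := cl_trans (.refl x) (.refl x)
        simpa using this
      rw [← cl_trans, Path.Homotopic.Quotient.trans_symm, h1]
    rw [cl_trans, cl_trans, add_right_comm, h0, zero_add]
    exact hc

variable {X : Type*} [MetricSpace X] [CATZero X] {B : Set X}

/-- The geodesic segment as a path in `B`. -/
noncomputable def segPath {u v : X} (h : ∀ t, geo u v t ∈ B) :
    Path (⟨u, by simpa [geo_zero] using h 0⟩ : B) ⟨v, by simpa [geo_one] using h 1⟩ where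
  toFun t := ⟨geo u v t, h t⟩
  continuous_toFun := by
    apply Continuous.subtype_mk
    fun_prop
  source' := Subtype.ext (by simp [geo_zero])
  target' := Subtype.ext (by simp [geo_one])

lemma homotopic_of_mem_ball {u v : B} (p q : Path u v) {o : X} {r : ℝ} (hB : ball o r ⊆ B)
    (hp : ∀ t, (p t : X) ∈ ball o r) (hq : ∀ t, (q t : X) ∈ ball o r) : p.Homotopic q := by
  refine ⟨⟨⟨⟨fun a => ⟨geo (p a.2 : X) (q a.2) a.1, hB (geo_mem_ball (hp _) (hq _) _)⟩, ?_⟩,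
    ?_, ?_⟩, ?_⟩⟩
  · apply Continuous.subtype_mk
    fun_prop
  · intro t; apply Subtype.ext; simp [geo_zero]
  · intro t; apply Subtype.ext; simp [geo_one]
  · rintro s t (rfl | rfl) <;> apply Subtype.ext <;> simp [geo_self]

open Classical in
lemma exists_cocycle_of_loopClassH1_ne_one (hB : IsOpen B) {x : B} {p : Path x x}
    (hp : loopClassH1 p ≠ 1) : ∃ φ : X → X → AddCircle (1 : ℚ), IsCocycleOn φ B ∧
      pint φ (fun t => (p.extend t : X)) ≠ 0 := by
  obtain ⟨K, hK, hKp⟩ := exists_groupoid_character hp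
  let φ : X → X → AddCircle (1 : ℚ) := fun a b =>
    if h : ∀ t, geo a b t ∈ B then K _ _ (.mk (segPath h)) else 0
  have hφK : ∀ {o : X} {r : ℝ} (hr : ball o r ⊆ B) {u v : B} (q : Path u v)
      (hq : ∀ t, (q t : X) ∈ ball o r), K u v (.mk q) = φ u v := by
    intro o r hr u v q hq
    have hu : (u : X) ∈ ball o r := by simpa using hq 0
    have hv : (v : X) ∈ ball o r := by simpa using hq 1
    have h : ∀ t, geo (u : X) v t ∈ B := fun t => hr (geo_mem_ball hu hv t)
    simp only [φ, dif_pos h]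
    congr 1
    exact Path.Homotopic.Quotient.eq.2
      (homotopic_of_mem_ball q (segPath h) hr hq fun t => geo_mem_ball hu hv t)
  refine ⟨φ, ?_, ?_⟩
  · intro b hb
    obtain ⟨r, hr, hrB⟩ := Metric.isOpen_iff.1 hB b hb
    refine ⟨ball b r, ball_mem_nhds b hr, fun x hx y hy z hz => ?_⟩
    have hxy : ∀ t, geo x y t ∈ B := fun t => hrB (geo_mem_ball hx hy t)
    have hyz : ∀ t, geo y z t ∈ B := fun t => hrB (geo_mem_ball hy hz t)
    have e1 := hφK hrB (segPath hxy) fun t => geo_mem_ball hx hy t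
    have e2 := hφK hrB (segPath hyz) fun t => geo_mem_ball hy hz t
    have e3 := hφK hrB ((segPath hxy).trans (segPath hyz)) fun t => by
      rw [Path.trans_apply]
      split_ifs
      · exact geo_mem_ball hx hy _
      · exact geo_mem_ball hy hz _
    rw [Path.Homotopic.Quotient.mk_trans, hK] at e3
    rw [← e1, ← e2, e3]
  · let F : ℝ → AddCircle (1 : ℚ) := fun t =>
      K _ _ (.mk (p.subpath 0 (projIcc 0 1 zero_le_one t)))
    have hF : IsPrim φ (fun t => (p.extend t : X)) F := by
      intro t
      obtain ⟨r, hr, hrB⟩ := Metric.isOpen_iff.1 hB _ (p.extend t).2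
      have hcont : Continuous fun t => (p.extend t : X) :=
        continuous_subtype_val.comp p.continuous_extend
      obtain ⟨η, hη, hball⟩ := Metric.continuous_iff.1 hcont t r hr
      filter_upwards [ball_mem_nhds t hη] with t' ht'
      have e := hK _ _ _ (.mk (p.subpath 0 (projIcc 0 1 zero_le_one t)))
        (.mk (p.subpath (projIcc 0 1 zero_le_one t) (projIcc 0 1 zero_le_one t')))
      rw [← Path.Homotopic.Quotient.mk_trans,
        Path.Homotopic.Quotient.eq.2 ⟨Path.Homotopy.subpathTransSubpath p _ _ _⟩] at e
      have e' := hφK hrB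
        (p.subpath (projIcc 0 1 zero_le_one t) (projIcc 0 1 zero_le_one t')) (by
        intro s
        have hs : p.subpath (projIcc 0 1 zero_le_one t) (projIcc 0 1 zero_le_one t') s ∈
          range (p.subpath (projIcc 0 1 zero_le_one t) (projIcc 0 1 zero_le_one t')) :=
          mem_range_self s
        rw [Path.range_subpath] at hs
        obtain ⟨a, ha, hae⟩ := hs
        rw [← hae]
        have ha' : ∃ b ∈ ball t η, projIcc 0 1 zero_le_one b = a := by
          have hpre : IsPreconnected (projIcc (0 : ℝ) 1 zero_le_one '' ball t η) := by
            refine IsPreconnected.image ?_ _ continuous_projIcc.continuousOn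
            rw [Real.ball_eq_Ioo]; exact isPreconnected_Ioo
          have hsub := hpre.ordConnected.uIcc_subset (mem_image_of_mem _ (mem_ball_self hη))
            (mem_image_of_mem _ ht')
          exact hsub ha
        obtain ⟨b, hb, rfl⟩ := ha'
        exact hball b hb)
      simp only [F]
      rw [e, add_sub_cancel_left]
      exact e'
    rw [hF.pint_eq]
    simp only [F]
    have h1 : projIcc (0 : ℝ) 1 zero_le_one 1 = 1 := projIcc_right _
    have h0 : projIcc (0 : ℝ) 1 zero_le_one 0 = 0 := projIcc_left _
    rw [h1, h0, Path.subpath_self, Path.subpath_zero_one]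
    have hz : K _ _ (.mk (Path.refl (p 0))) = 0 := by
      have := hK _ _ _ (.mk (Path.refl (p 0))) (.mk (Path.refl (p 0)))
      rw [Path.Homotopic.Quotient.mk_refl, Path.Homotopic.Quotient.trans_refl] at this
      simpa using this
    rw [hz, sub_zero]
    have gen : ∀ (u v : B) (hu : u = x) (hv : v = x),
        K u v (.mk (p.cast hu hv)) = K x x (.mk p) := by
      rintro u v rfl rfl; rfl
    rw [gen]
    exact hKp

lemma SCC.exists_cocycle_of_mem_interiorSet (γ : SCC X) {z : X} (hz : z ∈ γ.interiorSet) :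
    ∃ φ : X → X → AddCircle (1 : ℚ), IsCocycleOn φ {z}ᶜ ∧ pint φ γ.crv ≠ 0 := by
  obtain ⟨hz, hn⟩ := hz
  have hB : γ.img ⊆ {z}ᶜ := fun x hx (hxz : x = z) => hz (hxz ▸ hx)
  have : loopClassH1 (γ.pathIn _ hB) ≠ 1 := fun h => hn fun _ => h
  exact exists_cocycle_of_loopClassH1_ne_one isOpen_compl_singleton this

end Detection
end Homology

section Limits
open Topology
variable {X : Type*} [MetricSpace X] [CATZero X]

lemma pint_geo_add {A : Type*} [AddCommGroup A] {φ : X → X → A} {o : X} {r : ℝ}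
    (hφ : IsCocycleOn φ (ball o r)) :
    ∀ x ∈ ball o r, ∀ y ∈ ball o r, ∀ z ∈ ball o r,
      pint φ (geo x y) + pint φ (geo y z) = pint φ (geo x z) := by
  obtain ⟨χ, hχ⟩ := hφ.exists_isPrimOn_ball
  intro x hx y hy z hz
  rw [hχ.pint_geo_eq hx hy, hχ.pint_geo_eq hy hz, hχ.pint_geo_eq hx hz]
  abel

lemma IsCocycleOn.eventually_pint_geo_eq {A : Type*} [AddCommGroup A] {φ : X → X → A} {o : X}
    {r : ℝ} (hφ : IsCocycleOn φ (ball o r)) (hr : 0 < r) :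
    ∀ᶠ x in 𝓝 o, pint φ (geo o x) = φ o x := by
  obtain ⟨χ, hχ⟩ := hφ.exists_isPrimOn_ball
  filter_upwards [hχ o (mem_ball_self hr), ball_mem_nhds o hr] with x h1 h2
  rw [hχ.pint_geo_eq (mem_ball_self hr) h2, h1]

lemma SCC.mem_interiorSet_of_shrinking {A : Type*} [AddCommGroup A] (γ : SCC X) {z : X}
    (hz : z ∉ γ.img) {Q : ℕ → Set X} (hQ : ∀ η > 0, ∀ᶠ n in atTop, Q n ⊆ ball z η)
    {φ : ℕ → X → X → A} (hφ : ∀ n, IsCocycleOn (φ n) (Q n)ᶜ)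
    (hp : ∀ n, pint (φ n) γ.crv ≠ 0) : z ∈ γ.interiorSet := by
  let Ψ : X → X → Germ (atTop : Filter ℕ) A := fun x x' => ↑(fun n => pint (φ n) (geo x x'))
  have hΨ : IsCocycleOn Ψ {z}ᶜ := by
    intro b hb
    have hd : 0 < dist b z := dist_pos.2 hb
    refine ⟨ball b (dist b z / 2), ball_mem_nhds _ (by positivity), fun x hx y hy w hw => ?_⟩
    simp only [Ψ]
    rw [← Germ.coe_add, Germ.coe_eq]
    filter_upwards [hQ (dist b z / 2) (by positivity)] with n hn
    refine pint_geo_add ((hφ n).mono fun a ha haQ => ?_) x hx y hy w hw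
    have h1 := hn haQ
    rw [mem_ball] at ha h1
    have := dist_triangle_left b z a
    linarith
  obtain ⟨η, hη, hηd⟩ : ∃ η > 0, ∀ t, 2 * η ≤ dist (γ.crv t) z := by
    obtain ⟨r, hr, hb⟩ := Metric.isOpen_iff.1 γ.isCompact_img.isClosed.isOpen_compl z hz
    refine ⟨r / 2, by positivity, fun t => ?_⟩
    by_contra hc
    have hm : γ.crv t ∈ ball z r := by rw [mem_ball]; linarith
    exact hb hm (by rw [← γ.range_crv]; exact mem_range_self t)
  obtain ⟨N, hN⟩ := eventually_atTop.1 (hQ η hη)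
  have hball : ∀ n ≥ N, ∀ t, ball (γ.crv t) η ⊆ (Q n)ᶜ := by
    intro n hn t a ha haQ
    have h1 := hN n hn haQ
    rw [mem_ball] at ha h1
    have := dist_triangle_left (γ.crv t) z a
    have := hηd t
    linarith
  have hex : ∀ n, ∃ F : ℝ → A, N ≤ n → IsPrim (φ n) γ.crv F := by
    intro n
    by_cases hn : N ≤ n
    · obtain ⟨F, hF⟩ := (hφ n).exists_isPrim
        (⟨(γ.isPathOn_crv subset_rfl).cont, (γ.isPathOn_crv subset_rfl).clamp,
          fun t => hball n hn t (mem_ball_self hη)⟩ : IsPathOn (Q n)ᶜ γ.crv)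
      exact ⟨F, fun _ => hF⟩
    · exact ⟨0, fun h => absurd h hn⟩
  choose F hF using hex
  have hprim : IsPrim Ψ γ.crv (fun t => (↑(fun n => F n t) : Germ (atTop : Filter ℕ) A)) := by
    intro t
    obtain ⟨ε, hε, hεb⟩ := Metric.continuous_iff.1 (γ.isPathOn_crv subset_rfl).cont t η hη
    filter_upwards [ball_mem_nhds t hε] with t' ht'
    simp only [Ψ]
    rw [← Germ.coe_sub, Germ.coe_eq]
    filter_upwards [eventually_ge_atTop N] with n hn
    have hpr : IsPrim (fun x x' => pint (φ n) (geo x x')) γ.crv (F n) := by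
      intro s
      have h1 := ((hφ n).mono (hball n hn s)).eventually_pint_geo_eq hη
      filter_upwards [hF n hn s,
        ((γ.isPathOn_crv subset_rfl).cont.tendsto s).eventually h1] with s' e1 e2
      rw [e1, e2]
    refine hpr.sub_eq_of_isPreconnected (pint_geo_add ((hφ n).mono (hball n hn t)))
      (J := ball t ε) ?_ (fun s hs => hεb s hs) (mem_ball_self hε) ht'
    rw [Real.ball_eq_Ioo]; exact isPreconnected_Ioo
  refine γ.mem_interiorSet_of_pint_ne_zero hz hΨ ?_
  rw [hprim.pint_eq, ← Germ.coe_sub]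
  intro h0
  have h0' : ∀ᶠ n in atTop, F n 1 - F n 0 = 0 := Germ.coe_eq.1 h0
  obtain ⟨n, hn, hnN⟩ := (h0'.and (eventually_ge_atTop N)).exists
  exact hp n ((hF n hnN).pint_eq.trans hn)

lemma SCC.mem_of_tendsto (γ : SCC X) {u : ℕ → X} (hu : ∀ n, u n ∈ γ.img ∪ γ.interiorSet) {z : X}
    (hz : Tendsto u atTop (𝓝 z)) : z ∈ γ.img ∪ γ.interiorSet := by
  by_cases hzi : z ∈ γ.img
  · exact Or.inl hzi
  right
  have hev : ∀ᶠ n in atTop, u n ∈ γ.interiorSet := by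
    filter_upwards [hz.eventually (γ.isCompact_img.isClosed.isOpen_compl.mem_nhds hzi)] with n hn
    exact (hu n).resolve_left hn
  obtain ⟨N, hN⟩ := eventually_atTop.1 hev
  choose φ hφ hp using fun n =>
    γ.exists_cocycle_of_mem_interiorSet (hN (n + N) (Nat.le_add_left _ _))
  refine γ.mem_interiorSet_of_shrinking hzi (Q := fun n => {u (n + N)}) (fun η hη => ?_) hφ hp
  have := (tendsto_add_atTop_iff_nat N).2 hz
  filter_upwards [this.eventually (ball_mem_nhds z hη)] with n hn
  simpa using hn

lemma SCC.isClosed_img_union_interiorSet (γ : SCC X) : IsClosed (γ.img ∪ γ.interiorSet) := by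
  rw [← isSeqClosed_iff_isClosed]
  intro u z hu hz
  exact γ.mem_of_tendsto hu hz

lemma SCC.exists_isCompact_interiorSet_subset (γ : SCC X) :
    ∃ K : Set X, IsCompact K ∧ γ.interiorSet ⊆ K := by
  have hcr := (γ.isPathOn_crv subset_rfl)
  let o := γ.crv 0
  refine ⟨(fun a : ℝ × ℝ => geo o (γ.crv a.1) a.2) '' (Icc 0 1 ×ˢ Icc 0 1), ?_, ?_⟩
  · refine (isCompact_Icc.prod isCompact_Icc).image ?_
    have := hcr.cont
    fun_prop
  intro z hz
  by_contra hzK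
  obtain ⟨φ, hφ, hp⟩ := γ.exists_cocycle_of_mem_interiorSet hz
  have hmem : ∀ t s, geo o (γ.crv t) s ∈ ({z}ᶜ : Set X) := by
    intro t s h
    refine hzK ⟨(clamp t, clamp s), ⟨clamp_mem _, clamp_mem _⟩, ?_⟩
    simp only [geo_clamp, hcr.clamp]
    exact h
  have hh := pint_homotopy hφ (H := fun s t => geo o (γ.crv t) s)
    (by have := hcr.cont; fun_prop)
    (fun s => ⟨by have := hcr.cont; fun_prop, fun t => by rw [hcr.clamp], fun t => hmem t s⟩)
    (fun s s' => by rw [γ.crv_zero_eq_crv_one]) 0 1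
  simp only [geo_zero, geo_one] at hh
  refine hp (hh.symm.trans ?_)
  have ho : o ∈ ({z}ᶜ : Set X) := by simpa [geo_self, o] using hmem 0 0
  have h0 : IsPrim φ (fun _ : ℝ => o) (fun _ => 0) := by
    intro t
    simp [hφ.self ho]
  rw [h0.pint_eq, sub_self]

end Limits

section Local
open Topology
variable {X : Type*} [MetricSpace X]

/-- Compact subsets of metric spheres can be cut by finitely many points into finitely many
relatively open pieces of arbitrarily small diameter. -/
def HasSphereDecomposition (X : Type*) [MetricSpace X] : Prop :=
  ∀ (y : X) (ε : ℝ), 0 < ε → ∀ L : Set X, IsCompact L → L ⊆ sphere y ε → ∀ δ > 0,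
    ∃ (V : Set X) (n : ℕ) (O : Fin n → Set X), V.Finite ∧
      (∀ i, ∃ G, IsOpen G ∧ O i = G ∩ sphere y ε) ∧
      (∀ i j, i ≠ j → Disjoint (O i) (O j)) ∧
      (∀ i, Disjoint (O i) V) ∧
      (∀ i, ∀ a ∈ O i, ∀ b ∈ O i, dist a b ≤ δ) ∧
      (∀ i, (O i ∩ L).Nonempty) ∧
      (∀ i, closure (O i) ⊆ O i ∪ V) ∧
      L ⊆ V ∪ ⋃ i, O i

lemma exists_eventually_eq_of_finite {A : Type*} {V : Set X} (hV : V.Finite) (α : X → A) :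
    ∃ α' : X → A, ∀ v ∈ V, ∀ᶠ x in 𝓝 v, α' x = α v := by
  classical
  obtain ⟨U, hU, hd⟩ := hV.t2_separation
  refine ⟨fun x => if h : ∃ v ∈ V, x ∈ U v then α h.choose else α x, fun v hv => ?_⟩
  filter_upwards [(hU v).2.mem_nhds (hU v).1] with x hx
  have h : ∃ v ∈ V, x ∈ U v := ⟨v, hv, hx⟩
  rw [dif_pos h]
  congr 1
  by_contra hne
  exact (hd h.choose_spec.1 hv hne).le_bot ⟨h.choose_spec.2, hx⟩

variable [CATZero X]

/-- Radial projection to the sphere of radius `ε` around `y`. -/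
noncomputable def radial (y : X) (ε : ℝ) (x : X) : X := geo y x (ε / dist y x)

lemma dist_radial {y x : X} {ε : ℝ} (hε : 0 < ε) (h : ε ≤ dist y x) :
    dist y (radial y ε x) = ε := by
  have hd : 0 < dist y x := hε.trans_le h
  rw [radial, dist_left_geo, clamp_of_mem ⟨by positivity, by rwa [div_le_one hd]⟩]
  field_simp

lemma radial_of_dist_eq {y x : X} {ε : ℝ} (hε : 0 < ε) (h : dist y x = ε) :
    radial y ε x = x := by
  rw [radial, h, div_self hε.ne', geo_one]

lemma continuousAt_radial {y x : X} (ε : ℝ) (h : x ≠ y) : ContinuousAt (radial y ε) x := by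
  have hd : dist y x ≠ 0 := (dist_pos.2 h.symm).ne'
  have h1 : ContinuousAt (fun x => ε / dist y x) x := by
    apply ContinuousAt.div <;> first | exact hd | fun_prop
  exact (continuous_geo.continuousAt (x := (y, x, ε / dist y x))).comp
    (f := fun x => (y, x, ε / dist y x))
    (continuousAt_const.prodMk (continuousAt_id.prodMk h1))

variable {A : Type*} [AddCommGroup A]

open Classical in
/-- The cocycle supported near the sides of the radial sector over `O`. -/
noncomputable def sectorCocycle (y : X) (ε : ℝ) (O : Set X) (α : X → A) (x x' : X) : A :=
  (if ε < dist y x' ∧ radial y ε x' ∈ O then α (radial y ε x) else 0) -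
    (if ε < dist y x ∧ radial y ε x ∈ O then α (radial y ε x) else 0)

lemma isCocycleOn_sectorCocycle {y : X} {ε : ℝ} (hε : 0 < ε) {O V : Set X}
    (hO : ∃ G, IsOpen G ∧ O = G ∩ sphere y ε) (hcl : closure O ⊆ O ∪ V) {α α' : X → A}
    (hα : ∀ v ∈ V, ∀ᶠ x in 𝓝 v, α x = α' v) :
    IsCocycleOn (sectorCocycle y ε O α) (closure O)ᶜ := by
  obtain ⟨G, hG, rfl⟩ := hO
  set O := G ∩ sphere y ε
  intro b hb
  let S : Set X := {x | ε < dist y x ∧ radial y ε x ∈ O}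
  by_cases hbS : b ∈ S
  · have hby : b ≠ y := by rintro rfl; have := hbS.1; simp at this; linarith
    have h1 : ∀ᶠ x in 𝓝 b, ε < dist y x :=
      (continuous_const.dist continuous_id).continuousAt.eventually
        (isOpen_Ioi.mem_nhds hbS.1)
    have h2 : ∀ᶠ x in 𝓝 b, radial y ε x ∈ G :=
      (continuousAt_radial ε hby).eventually (hG.mem_nhds hbS.2.1)
    refine ⟨{x | x ∈ S}, ?_, ?_⟩
    · filter_upwards [h1, h2] with x h1 h2
      exact ⟨h1, h2, by rw [mem_sphere, dist_comm]; exact dist_radial hε h1.le⟩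
    · intro x hx x' hx' x'' hx''
      have e : ∀ x, x ∈ S → ∀ x', x' ∈ S → sectorCocycle y ε O α x x' = 0 := by
        intro x hx x' hx'
        have hx1 : ε < dist y x ∧ radial y ε x ∈ O := hx
        have hx2 : ε < dist y x' ∧ radial y ε x' ∈ O := hx'
        simp [sectorCocycle, hx1, hx2]
      rw [e _ hx _ hx', e _ hx' _ hx'', e _ hx _ hx'', add_zero]
  by_cases hbc : b ∈ closure S
  · have hdb : ε ≤ dist y b := by
      have hcl : IsClosed {x | ε ≤ dist y x} :=
        isClosed_le continuous_const (continuous_const.dist continuous_id)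
      exact closure_minimal (fun x hx => hx.1.le) hcl hbc
    have hby : b ≠ y := by rintro rfl; simp at hdb; linarith
    have hrb : radial y ε b ∈ closure O :=
      mem_closure_image (continuousAt_radial ε hby) hbc |>
        closure_mono (by rintro _ ⟨x, hx, rfl⟩; exact hx.2)
    have hlt : ε < dist y b := by
      refine lt_of_le_of_ne hdb fun h => hb ?_
      rwa [radial_of_dist_eq hε h.symm] at hrb
    have hV : radial y ε b ∈ V := (hcl hrb).resolve_left fun h => hbS ⟨hlt, h⟩
    refine ⟨{x | α (radial y ε x) = α' (radial y ε b)},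
      (continuousAt_radial ε hby).eventually (hα _ hV), ?_⟩
    intro x hx x' hx' x'' hx''
    have hx1 : α (radial y ε x) = α' (radial y ε b) := hx
    have hx2 : α (radial y ε x') = α' (radial y ε b) := hx'
    simp only [sectorCocycle, hx1, hx2]
    abel
  · refine ⟨Sᶜ, mem_of_superset (isClosed_closure.isOpen_compl.mem_nhds hbc)
      (compl_subset_compl.2 subset_closure), ?_⟩
    have e : ∀ x, x ∈ Sᶜ → ∀ x', x' ∈ Sᶜ → sectorCocycle y ε O α x x' = 0 := by
      intro x hx x' hx'
      have hx1 : ¬ (ε < dist y x ∧ radial y ε x ∈ O) := hx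
      have hx2 : ¬ (ε < dist y x' ∧ radial y ε x' ∈ O) := hx'
      simp only [sectorCocycle, if_neg hx1, if_neg hx2, sub_zero]
    intro x hx x' hx' x'' hx''
    rw [e _ hx _ hx', e _ hx' _ hx'', e _ hx _ hx'', add_zero]

open Classical in
/-- If all sector cocycles have vanishing periods along a loop, so does the given cocycle along
the radial projection of the loop. -/
lemma pint_eq_zero_of_sector_periods {y : X} {ε : ℝ} (hε : 0 < ε) {Φ : X → X → A}
    (hΦ : IsCocycleOn Φ {y}ᶜ) {c : ℝ → X} (hc : IsPathOn {x | ε < dist y x} c)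
    (hloop : c 0 = c 1) {V : Set X} (hV : V.Finite) {n : ℕ} {O U : Fin n → Set X}
    (hO : ∀ i, ∃ G, IsOpen G ∧ O i = G ∩ sphere y ε)
    (hdisj : ∀ i j, i ≠ j → Disjoint (O i) (O j)) (hOV : ∀ i, Disjoint (O i) V)
    (hcl : ∀ i, closure (O i) ⊆ O i ∪ V) (hcov : ∀ t, radial y ε (c t) ∈ V ∪ ⋃ i, O i)
    (hU : ∀ i, closure (O i) ⊆ U i) {h : Fin n → X → A} (hh : ∀ i, IsPrimOn Φ (U i) (h i))
    {χ : X → A} {α : Fin n → X → A}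
    (hα : ∀ i, ∀ v ∈ V, ∀ᶠ x in 𝓝 v, α i x = χ v - h i v)
    (hper : ∀ i, pint (sectorCocycle y ε (O i) (α i)) c = 0) :
    pint Φ (fun t => radial y ε (c t)) = 0 := by
  have hcy : ∀ t, c t ≠ y := fun t ht => by
    have := hc.mem t
    rw [ht] at this
    simp at this; linarith
  set σ : ℝ → X := fun t => radial y ε (c t) with hσ
  have hσd : ∀ t, dist y (σ t) = ε := fun t => dist_radial hε (hc.mem t).le
  have hσs : ∀ t, σ t ∈ sphere y ε := fun t => by rw [mem_sphere, dist_comm]; exact hσd t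
  have hσc : Continuous σ := continuous_iff_continuousAt.2 fun t =>
    (continuousAt_radial ε (hcy t)).comp hc.cont.continuousAt
  have hσp : IsPathOn {y}ᶜ σ := ⟨hσc, fun t => by simp only [hσ, hc.clamp], fun t ht => by
    have := hσd t
    rw [show σ t = y from ht, dist_self] at this
    linarith⟩
  obtain ⟨F, hF⟩ := hΦ.exists_isPrim hσp
  have hex : ∀ i, ∃ Fi : ℝ → A, IsPrim (sectorCocycle y ε (O i) (α i)) c Fi := by
    intro i
    refine (isCocycleOn_sectorCocycle hε (hO i) (hcl i) (hα i)).exists_isPrim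
      ⟨hc.cont, hc.clamp, fun t ht => ?_⟩
    have hsub : closure (O i) ⊆ sphere y ε := by
      obtain ⟨G, -, hG⟩ := hO i
      exact closure_minimal (hG ▸ inter_subset_right) isClosed_sphere
    have h1 := hsub ht
    rw [mem_sphere, dist_comm] at h1
    have : ε < dist y (c t) := hc.mem t
    linarith
  choose Fi hFi using hex
  let χ' : X → A := fun x => if hx : ∃ i, x ∈ O i then h hx.choose x else χ x
  have hχO : ∀ i, ∀ x ∈ O i, χ' x = h i x := by
    intro i x hx
    have hx' : ∃ i, x ∈ O i := ⟨i, hx⟩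
    have : hx'.choose = i := by
      by_contra hne
      exact (hdisj _ _ hne).le_bot ⟨hx'.choose_spec, hx⟩
    simp only [χ', dif_pos hx', this]
  have hχV : ∀ x ∈ V, χ' x = χ x := by
    intro x hx
    have hx' : ¬ ∃ i, x ∈ O i := fun ⟨i, hi⟩ => (hOV i).le_bot ⟨hi, hx⟩
    simp only [χ', dif_neg hx']
  have hsec : ∀ i t t', sectorCocycle y ε (O i) (α i) (c t) (c t') =
      (if σ t' ∈ O i then α i (σ t) else 0) - (if σ t ∈ O i then α i (σ t) else 0) := by
    intro i t t'
    have h1 : ε < dist y (c t) := hc.mem t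
    have h2 : ε < dist y (c t') := hc.mem t'
    simp only [sectorCocycle, h1, h2, true_and, hσ]
  have hlc : IsLocallyConstant fun t => F t - χ' (σ t) - ∑ i, Fi i t := by
    rw [IsLocallyConstant.iff_eventually_eq]
    intro t
    have hall : ∀ᶠ t' in 𝓝 t, ∀ i, Fi i t' - Fi i t =
      (if σ t' ∈ O i then α i (σ t) else 0) - (if σ t ∈ O i then α i (σ t) else 0) := by
      rw [eventually_all]
      intro i
      filter_upwards [hFi i t] with t' ht'
      rw [ht', hsec]
    rcases hcov t with htV | htO
    · change σ t ∈ V at htV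
      have hnO : ∀ i, σ t ∉ O i := fun i hi => (hOV i).le_bot ⟨hi, htV⟩
      have h1 : ∀ᶠ t' in 𝓝 t, σ t' ∈ V → σ t' = σ t := by
        have hop : IsOpen (V \ {σ t})ᶜ := (hV.subset sdiff_subset).isClosed.isOpen_compl
        filter_upwards [hσc.continuousAt.eventually (hop.mem_nhds (by simp))] with t' ht' hv
        by_contra hne
        exact ht' ⟨hv, hne⟩
      have h2 : ∀ᶠ t' in 𝓝 t, ∀ i, σ t' ∈ O i →
          σ t ∈ U i ∧ h i (σ t') - h i (σ t) = Φ (σ t) (σ t') := by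
        rw [eventually_all]
        intro i
        by_cases hi : σ t ∈ closure (O i)
        · filter_upwards [hσc.continuousAt.eventually (hh i _ (hU i hi))] with t' ht' _
          exact ⟨hU i hi, ht'⟩
        · filter_upwards [hσc.continuousAt.eventually
            (isClosed_closure.isOpen_compl.mem_nhds hi)] with t' ht' hO'
          exact absurd (subset_closure hO') ht'
      filter_upwards [h1, h2, hall, hF t] with t' h1 h2 h3 h4
      simp only [hnO, if_false, sub_zero] at h3
      rw [← sub_eq_zero]
      have hdiff : F t' - χ' (σ t') - ∑ i, Fi i t' - (F t - χ' (σ t) - ∑ i, Fi i t) =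
          (F t' - F t) - (χ' (σ t') - χ' (σ t)) - ∑ i, (Fi i t' - Fi i t) := by
        rw [Finset.sum_sub_distrib]; abel
      rw [hdiff, Finset.sum_congr rfl fun i _ => h3 i, h4, hχV _ htV]
      rcases hcov t' with htV' | htO'
      · have he := h1 htV'
        change σ t' ∈ V at htV'
        rw [he] at htV' ⊢
        simp [hnO, hχV _ htV', hΦ.self (hσp.mem t)]
      · obtain ⟨i, hi⟩ := mem_iUnion.1 htO'
        change σ t' ∈ O i at hi
        obtain ⟨-, h5⟩ := h2 i hi
        have hj : ∀ j, j ≠ i → σ t' ∉ O j := fun j hj hm => (hdisj j i hj).le_bot ⟨hm, hi⟩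
        rw [Finset.sum_eq_single i (fun j _ hji => if_neg (hj j hji)) (by simp), if_pos hi,
          hχO i _ hi, (hα i _ htV).self_of_nhds, ← h5]
        abel
    · obtain ⟨i, hi⟩ := mem_iUnion.1 htO
      change σ t ∈ O i at hi
      obtain ⟨G, hG, hGO⟩ := hO i
      have hmem : ∀ᶠ t' in 𝓝 t, σ t' ∈ O i := by
        have : σ t ∈ G := by rw [hGO] at hi; exact hi.1
        filter_upwards [hσc.continuousAt.eventually (hG.mem_nhds this)] with t' ht'
        rw [hGO]; exact ⟨ht', hσs t'⟩
      filter_upwards [hmem, hall, hF t,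
        hσc.continuousAt.eventually (hh i _ (hU i (subset_closure hi)))] with t' h1 h3 h4 h5
      have h6 : ∀ j, Fi j t' = Fi j t := by
        intro j
        rw [← sub_eq_zero, h3 j]
        by_cases hji : j = i
        · subst hji; simp [h1, hi]
        · have e1 : σ t' ∉ O j := fun hm => (hdisj j i hji).le_bot ⟨hm, h1⟩
          have e2 : σ t ∉ O j := fun hm => (hdisj j i hji).le_bot ⟨hm, hi⟩
          simp [e1, e2]
      simp only [h6]
      congr 1
      rw [hχO i _ h1, hχO i _ hi, sub_eq_sub_iff_sub_eq_sub, h4, h5]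
  have hend := hlc.apply_eq_of_preconnectedSpace 1 0
  have hs : σ 1 = σ 0 := by simp only [hσ, hloop]
  have hFi0 : ∀ i, Fi i 1 = Fi i 0 := fun i => by
    have := hper i
    rwa [(hFi i).pint_eq, sub_eq_zero] at this
  simp only [hFi0, hs] at hend
  rw [hF.pint_eq, sub_eq_zero]
  simpa using hend

lemma exists_isPrimOn_detour (p : X) {y : X} {Φ : X → X → A} (hΦ : IsCocycleOn Φ {y}ᶜ) :
    ∃ χ : X → A, IsPrimOn Φ {x | dist p x < dist p y + dist y x} χ := by
  refine (hΦ.mono ?_).exists_isPrimOn (o := p) ?_ ?_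
  · rintro x hx rfl
    simp at hx
  · exact isOpen_lt (by fun_prop) (by fun_prop)
  · intro x hx t
    have h1 : dist p x < dist p y + dist y x := hx
    have h2 := dist_geo_add p x t
    have h3 := dist_triangle y (geo p x t) x
    change dist p (geo p x t) < dist p y + dist y (geo p x t)
    linarith

lemma exists_small_obstruction (hdec : HasSphereDecomposition X) (p : X) {y : X} {ε δ : ℝ}
    (hδ : 0 < δ) (hδε : 2 * δ < ε) {Φ : X → X → A} (hΦ : IsCocycleOn Φ {y}ᶜ) {c : ℝ → X}
    (hc : IsPathOn {x | ε < dist y x} c) (hloop : c 0 = c 1) {L : Set X} (hL : IsCompact L)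
    (hLs : L ⊆ sphere y ε) (hcL : ∀ t, radial y ε (c t) ∈ L)
    (hper : pint Φ (fun t => radial y ε (c t)) ≠ 0) :
    ∃ o ∈ L, ∃ Q ⊆ closedBall o δ, ∃ w ∈ ball o (2 * δ), dist p y + dist y w ≤ dist p w ∧
      ∃ φ : X → X → A, IsCocycleOn φ Qᶜ ∧ pint φ c ≠ 0 := by
  classical
  have hε : 0 < ε := by linarith
  obtain ⟨χ, hχ⟩ := exists_isPrimOn_detour p hΦ
  set W : Set X := {x | dist p x < dist p y + dist y x} with hW
  obtain ⟨V, n, O, hV, hO, hdisj, hOV, hdiam, hOL, hcl, hcov⟩ := hdec y ε hε L hL hLs δ hδ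
  choose o ho using hOL
  have hU : ∀ i, closure (O i) ⊆ closedBall (o i) δ := fun i =>
    closure_minimal (fun x hx => hdiam i x hx _ (ho i).1) isClosed_closedBall
  have hh : ∀ i, ∃ h : X → A, IsPrimOn Φ (ball (o i) (2 * δ)) h ∧
      (ball (o i) (2 * δ) ⊆ W → h = χ) := by
    intro i
    by_cases hi : ball (o i) (2 * δ) ⊆ W
    · exact ⟨χ, fun x hx => hχ x (hi hx), fun _ => rfl⟩
    · have : IsCocycleOn Φ (ball (o i) (2 * δ)) := by
        refine hΦ.mono fun x hx hxy => ?_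
        rw [show x = y from hxy, mem_ball, dist_comm] at hx
        have := hLs (ho i).2
        rw [mem_sphere] at this
        linarith
      obtain ⟨h, hh⟩ := this.exists_isPrimOn_ball
      exact ⟨h, hh, fun h => absurd h hi⟩
  choose h hh hhW using hh
  choose α hα using fun i => exists_eventually_eq_of_finite hV (fun v => χ v - h i v)
  let α' : Fin n → X → A := fun i => if ball (o i) (2 * δ) ⊆ W then 0 else α i
  have hα' : ∀ i, ∀ v ∈ V, ∀ᶠ x in 𝓝 v, α' i x = χ v - h i v := by
    intro i v hv
    by_cases hi : ball (o i) (2 * δ) ⊆ W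
    · simp [α', hi, hhW i hi]
    · simpa [α', hi] using hα i v hv
  by_contra hcon
  push Not at hcon
  refine hper (pint_eq_zero_of_sector_periods hε hΦ hc hloop hV hO hdisj hOV hcl
    (fun t => hcov (hcL t)) (U := fun i => ball (o i) (2 * δ))
    (fun i => (hU i).trans (closedBall_subset_ball (by linarith))) hh hα' fun i => ?_)
  by_cases hi : ball (o i) (2 * δ) ⊆ W
  · have h0 : IsPrim (sectorCocycle y ε (O i) (α' i)) c (fun _ => 0) := by
      intro t
      simp [sectorCocycle, α', hi]
    rw [h0.pint_eq, sub_self]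
  · obtain ⟨w, hw, hwW⟩ := not_subset.1 hi
    exact hcon (o i) (ho i).2 (closure (O i)) (hU i) w hw (not_lt.1 hwW) _
      (isCocycleOn_sectorCocycle hε (hO i) (hcl i) (hα' i))

lemma SCC.exists_further_interior_point (γ : SCC X) (hdec : HasSphereDecomposition X) (p : X)
    {y : X} (hy : y ∈ γ.interiorSet) {ε : ℝ} (hε : 0 < ε) (hγ : ∀ x ∈ γ.img, ε < dist y x) :
    ∃ z ∈ γ.interiorSet, dist y z = ε ∧ dist p z = dist p y + ε := by
  obtain ⟨Φ, hΦ, hper⟩ := γ.exists_cocycle_of_mem_interiorSet hy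
  have hc : IsPathOn {x | ε < dist y x} γ.crv := γ.isPathOn_crv hγ
  have hcd : ∀ t, ε < dist y (γ.crv t) := hc.mem
  have hcy : ∀ t, γ.crv t ≠ y := fun t ht => by
    have := hcd t
    rw [ht, dist_self] at this
    linarith
  set σ : ℝ → X := fun t => radial y ε (γ.crv t) with hσ
  have hσd : ∀ t, dist y (σ t) = ε := fun t => dist_radial hε (hcd t).le
  have hσc : Continuous σ := continuous_iff_continuousAt.2 fun t =>
    (continuousAt_radial ε (hcy t)).comp hc.cont.continuousAt
  have hσcl : ∀ t, σ (Cat2Cx.clamp t) = σ t := fun t => by simp only [hσ, hc.clamp]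
  have hσper : pint Φ σ ≠ 0 := by
    have hcc := hc.cont
    have := pint_homotopy hΦ (H := fun s t => geo (γ.crv t) (σ t) s) (by fun_prop)
      (fun s => ⟨by fun_prop, fun t => by rw [hc.clamp, hσcl], fun t ht => ?_⟩)
      (fun s s' => by
        have : σ 0 = σ 1 := by simp only [hσ, γ.crv_zero_eq_crv_one]
        rw [γ.crv_zero_eq_crv_one, this]) 0 1
    · simp only [geo_zero, geo_one] at this
      intro h0
      exact hper (this.trans h0)
    · have h1 := dist_geo_add (γ.crv t) (σ t) s
      rw [show geo (γ.crv t) (σ t) s = y from ht, hσd] at h1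
      have h2 : dist y (σ t) + dist (σ t) (γ.crv t) = dist y (γ.crv t) := dist_geo_add _ _ _
      rw [hσd, dist_comm (σ t), dist_comm y (γ.crv t)] at h2
      linarith
  have hL : IsCompact (σ '' Icc 0 1) := isCompact_Icc.image hσc
  have hLs : σ '' Icc 0 1 ⊆ sphere y ε := by
    rintro _ ⟨t, -, rfl⟩
    rw [mem_sphere, dist_comm]; exact hσd t
  have hcL : ∀ t, σ t ∈ σ '' Icc 0 1 := fun t => ⟨_, clamp_mem t, hσcl t⟩
  let δ : ℕ → ℝ := fun n => ε / 4 / (n + 1)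
  have hδ : ∀ n, 0 < δ n := fun n => by positivity
  have hδ0 : Tendsto δ atTop (𝓝 0) := by
    have := (tendsto_one_div_add_atTop_nhds_zero_nat (𝕜 := ℝ)).const_mul (ε / 4)
    simpa [δ, div_eq_mul_inv] using this
  have hδε : ∀ n, 2 * δ n < ε := by
    intro n
    have h1 : δ n ≤ ε / 4 := div_le_self (by positivity) (by linarith [n.cast_nonneg (α := ℝ)])
    linarith
  choose o hoL Q hQ w hw hwW φ hφ hp using fun n => exists_small_obstruction hdec p (hδ n) (hδε n)
    hΦ hc γ.crv_zero_eq_crv_one hL hLs hcL hσper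
  obtain ⟨z, hzL, k, hk, hkz⟩ := hL.tendsto_subseq hoL
  have hzd : dist y z = ε := by
    have := hLs hzL
    rwa [mem_sphere, dist_comm] at this
  have hδk : Tendsto (fun n => δ (k n)) atTop (𝓝 0) := hδ0.comp hk.tendsto_atTop
  have hzγ : z ∉ γ.img := fun h => (hγ z h).ne' hzd
  refine ⟨z, ?_, hzd, ?_⟩
  · refine γ.mem_interiorSet_of_shrinking hzγ (Q := fun n => Q (k n)) (fun η hη => ?_)
      (fun n => hφ (k n)) (fun n => hp (k n))
    filter_upwards [hkz.eventually (ball_mem_nhds z (half_pos hη)),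
      hδk.eventually (gt_mem_nhds (half_pos hη))] with n h1 h2 x hx
    have h3 := hQ _ hx
    rw [mem_closedBall] at h3
    have h4 : dist (o (k n)) z < η / 2 := h1
    rw [mem_ball]
    linarith [dist_triangle x (o (k n)) z]
  · have hwz : Tendsto (fun n => w (k n)) atTop (𝓝 z) := by
      rw [tendsto_iff_dist_tendsto_zero]
      have h0 : Tendsto (fun n => 2 * δ (k n) + dist (o (k n)) z) atTop (𝓝 0) := by
        have := (hδk.const_mul 2).add (tendsto_iff_dist_tendsto_zero.1 hkz)
        simpa using this
      refine squeeze_zero (fun _ => dist_nonneg) (fun n => ?_) h0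
      have h1 := hw (k n)
      rw [mem_ball] at h1
      linarith [dist_triangle (w (k n)) (o (k n)) z]
    have hge : dist p y + dist y z ≤ dist p z :=
      le_of_tendsto_of_tendsto' (tendsto_const_nhds.add (tendsto_const_nhds.dist hwz))
        (tendsto_const_nhds.dist hwz) fun n => hwW (k n)
    rw [hzd] at hge
    have := dist_triangle p y z
    rw [hzd] at this
    exact le_antisymm this hge

end Local

section ModelPlane
open Topology

lemma arcosh_cosh (x : ℝ) : arcosh (Real.cosh x) = |x| := by
  rw [← Real.cosh_abs]
  exact Real.arcosh_cosh (abs_nonneg x)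

/-- The Lorentz factor `√(1 + |u|²)` of a point of the hyperboloid. -/
noncomputable def lorentz (u : ℝ × ℝ) : ℝ := Real.sqrt (1 + u.1 ^ 2 + u.2 ^ 2)

lemma lorentz_pos (u : ℝ × ℝ) : 0 < lorentz u := Real.sqrt_pos.2 (by positivity)

lemma lorentz_sq (u : ℝ × ℝ) : lorentz u ^ 2 = 1 + u.1 ^ 2 + u.2 ^ 2 :=
  Real.sq_sqrt (by positivity)

/-- Minus the Lorentz product of two points of the hyperboloid. -/
noncomputable def lorentzProd (u v : ℝ × ℝ) : ℝ := lorentz u * lorentz v - u.1 * v.1 - u.2 * v.2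

/-- The Klein coordinates of a point of the hyperboloid. -/
noncomputable def klein (u : ℝ × ℝ) : ℝ × ℝ := (u.1 / lorentz u, u.2 / lorentz u)

lemma fst_eq (u : ℝ × ℝ) : u.1 = (klein u).1 * lorentz u := by
  simp [klein, (lorentz_pos u).ne']

lemma snd_eq (u : ℝ × ℝ) : u.2 = (klein u).2 * lorentz u := by
  simp [klein, (lorentz_pos u).ne']

lemma lorentz_sq_mul (u : ℝ × ℝ) :
    lorentz u ^ 2 * (1 - (klein u).1 ^ 2 - (klein u).2 ^ 2) = 1 := by
  have h := lorentz_sq u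
  rw [fst_eq u, snd_eq u] at h
  linear_combination h

lemma klein_sq_lt (u : ℝ × ℝ) : 0 < 1 - (klein u).1 ^ 2 - (klein u).2 ^ 2 := by
  have h := lorentz_sq_mul u
  have := lorentz_pos u
  by_contra! hc
  nlinarith [sq_nonneg (lorentz u)]

lemma lorentzProd_eq (u v : ℝ × ℝ) : lorentzProd u v =
    lorentz u * lorentz v * (1 - (klein u).1 * (klein v).1 - (klein u).2 * (klein v).2) := by
  rw [lorentzProd]
  linear_combination (-v.1) * fst_eq u - (klein u).1 * lorentz u * fst_eq v +
    (-v.2) * snd_eq u - (klein u).2 * lorentz u * snd_eq v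

lemma lorentzProd_pos (u v : ℝ × ℝ) : 0 < lorentzProd u v := by
  rw [lorentzProd_eq]
  refine mul_pos (mul_pos (lorentz_pos u) (lorentz_pos v)) ?_
  nlinarith [klein_sq_lt u, klein_sq_lt v, sq_nonneg ((klein u).1 - (klein v).1),
    sq_nonneg ((klein u).2 - (klein v).2)]

lemma sq_klein_sub_le (u v : ℝ × ℝ) : ((klein u).1 - (klein v).1) ^ 2 +
    ((klein u).2 - (klein v).2) ^ 2 ≤ lorentzProd u v ^ 2 - 1 := by
  have hu := lorentz_sq_mul u
  have hv := lorentz_sq_mul v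
  have hu' := klein_sq_lt u
  have hv' := klein_sq_lt v
  rw [lorentzProd_eq]
  generalize (klein u).1 = a at *
  generalize (klein u).2 = b at *
  generalize (klein v).1 = c at *
  generalize (klein v).2 = d at *
  have hm : 1 ≤ lorentz u ^ 2 := by nlinarith [lorentz_sq u, sq_nonneg u.1, sq_nonneg u.2]
  have hn : 0 ≤ lorentz v ^ 2 := sq_nonneg _
  have key : (lorentz u * lorentz v * (1 - a * c - b * d)) ^ 2 - 1 =
      lorentz u ^ 2 * (lorentz v ^ 2 * ((a - c) ^ 2 + (b - d) ^ 2 - (a * d - b * c) ^ 2)) := by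
    linear_combination (lorentz v ^ 2 * (1 - c ^ 2 - d ^ 2)) * hu + hv
  have h2 : (1 - c ^ 2 - d ^ 2) * ((a - c) ^ 2 + (b - d) ^ 2) ≤
      (a - c) ^ 2 + (b - d) ^ 2 - (a * d - b * c) ^ 2 := by
    nlinarith [sq_nonneg ((a - c) * c + (b - d) * d)]
  have h3 := mul_le_mul_of_nonneg_left h2 hn
  rw [← mul_assoc, hv, one_mul] at h3
  rw [key]
  nlinarith [sq_nonneg (a - c), sq_nonneg (b - d)]

lemma one_le_lorentzProd (u v : ℝ × ℝ) : 1 ≤ lorentzProd u v := by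
  have h := sq_klein_sub_le u v
  nlinarith [lorentzProd_pos u v, sq_nonneg ((klein u).1 - (klein v).1),
    sq_nonneg ((klein u).2 - (klein v).2)]

lemma mDist_of_neg {κ : ℝ} (hκ : κ < 0) (u v : ℝ × ℝ) :
    mDist κ u v = 1 / Real.sqrt (-κ) * Real.arcosh (lorentzProd u v) := by
  rw [mDist, if_neg hκ.ne]; rfl

lemma dist_klein_le {κ : ℝ} (hκ : κ < 0) (u v : ℝ × ℝ) :
    dist (klein u) (klein v) ≤ Real.sinh (Real.sqrt (-κ) * mDist κ u v) := by
  have hs : 0 < Real.sqrt (-κ) := Real.sqrt_pos.2 (by linarith)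
  rw [mDist_of_neg hκ, ← mul_assoc, mul_one_div_cancel hs.ne', one_mul,
    Real.sinh_arcosh (one_le_lorentzProd u v)]
  have h := sq_klein_sub_le u v
  rw [Prod.dist_eq, Real.dist_eq, Real.dist_eq]
  refine max_le ?_ ?_ <;> refine Real.abs_le_sqrt ?_
  · nlinarith [sq_nonneg ((klein u).2 - (klein v).2)]
  · nlinarith [sq_nonneg ((klein u).1 - (klein v).1)]

lemma lorentzProd_eq_cosh {u v : ℝ × ℝ} (h : (klein u).1 = (klein v).1) :
    lorentzProd u v = Real.cosh (Real.arsinh u.2 - Real.arsinh v.2) := by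
  rw [Real.cosh_sub, Real.cosh_arsinh, Real.cosh_arsinh, Real.sinh_arsinh, Real.sinh_arsinh,
    lorentzProd]
  have hc : 0 < 1 - (klein u).1 ^ 2 := by nlinarith [klein_sq_lt u, sq_nonneg (klein u).2]
  have e (z : ℝ × ℝ) (hz : (klein z).1 = (klein u).1) :
      Real.sqrt (1 + z.2 ^ 2) = lorentz z * Real.sqrt (1 - (klein u).1 ^ 2) := by
    rw [← Real.sqrt_sq (lorentz_pos z).le, ← Real.sqrt_mul (sq_nonneg _)]
    congr 1
    have h1 := lorentz_sq z
    have h2 := fst_eq z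
    rw [hz] at h2
    rw [h2] at h1
    linear_combination -h1
  rw [e u rfl, e v h.symm]
  have h1 := Real.mul_self_sqrt hc.le
  have h2 := fst_eq u
  have h3 := fst_eq v
  rw [← h] at h3
  linear_combination (-lorentz u * lorentz v) * h1 - v.1 * h2 - (klein u).1 * lorentz u * h3

lemma klein_swap (u : ℝ × ℝ) : klein u.swap = (klein u).swap := by
  have : lorentz u.swap = lorentz u := by
    rw [lorentz, lorentz]; congr 1; simp only [Prod.fst_swap, Prod.snd_swap]; ring
  simp [klein, this]

lemma mDist_swap (κ : ℝ) (u v : ℝ × ℝ) : mDist κ u.swap v.swap = mDist κ u v := by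
  simp only [mDist, Prod.fst_swap, Prod.snd_swap]
  congr 1
  · congr 1; ring
  · congr 2
    rw [add_right_comm 1 (u.2 ^ 2), add_right_comm 1 (v.2 ^ 2)]
    ring

lemma mDist_of_klein_fst {κ : ℝ} (hκ : κ < 0) {u v : ℝ × ℝ} (h : (klein u).1 = (klein v).1) :
    mDist κ u v =
      |1 / Real.sqrt (-κ) * Real.arsinh u.2 - 1 / Real.sqrt (-κ) * Real.arsinh v.2| := by
  rw [mDist_of_neg hκ, lorentzProd_eq_cosh h, ← mul_sub, abs_mul,
    abs_of_nonneg (by positivity : 0 ≤ 1 / Real.sqrt (-κ))]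
  congr 1
  exact arcosh_cosh _

lemma mDist_of_klein_snd {κ : ℝ} (hκ : κ < 0) {u v : ℝ × ℝ} (h : (klein u).2 = (klein v).2) :
    mDist κ u v =
      |1 / Real.sqrt (-κ) * Real.arsinh u.1 - 1 / Real.sqrt (-κ) * Real.arsinh v.1| := by
  rw [← mDist_swap]
  exact mDist_of_klein_fst hκ (by simpa [klein_swap] using h)

lemma lorentz_eq (u : ℝ × ℝ) :
    lorentz u = (Real.sqrt (1 - (klein u).1 ^ 2 - (klein u).2 ^ 2))⁻¹ := by
  have h := lorentz_sq_mul u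
  rw [← Real.sqrt_inv, ← Real.sqrt_sq (lorentz_pos u).le]
  congr 1
  exact eq_inv_of_mul_eq_one_left h

lemma exists_mDist_lt_of_klein {κ : ℝ} (hκ : κ < 0) (v : ℝ × ℝ) {δ : ℝ} (hδ : 0 < δ) :
    ∃ ρ > 0, ∀ u, dist (klein u) (klein v) < ρ → mDist κ u v < δ := by
  let B : ℝ × ℝ → ℝ := fun k => (Real.sqrt (1 - k.1 ^ 2 - k.2 ^ 2))⁻¹ * lorentz v *
    (1 - k.1 * (klein v).1 - k.2 * (klein v).2)
  let h : ℝ × ℝ → ℝ := fun k =>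
    1 / Real.sqrt (-κ) * Real.log (B k + Real.sqrt (B k ^ 2 - 1))
  have hB (u) : B (klein u) = lorentzProd u v := by
    rw [lorentzProd_eq, lorentz_eq u]
  have hh (u) : h (klein u) = mDist κ u v := by
    simp only [h, hB]; rw [mDist_of_neg hκ]; rfl
  have cB : ContinuousAt B (klein v) := by
    refine ContinuousAt.mul (ContinuousAt.mul (ContinuousAt.inv₀ (by fun_prop) ?_)
      continuousAt_const) (by fun_prop)
    exact (Real.sqrt_pos.2 (klein_sq_lt v)).ne'
  have ch : ContinuousAt h (klein v) := by
    refine continuousAt_const.mul (ContinuousAt.log (by fun_prop) ?_)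
    rw [hB]
    have := lorentzProd_pos v v
    positivity
  have h0 : h (klein v) = 0 := by
    rw [hh, mDist_of_klein_fst hκ rfl, sub_self, abs_zero]
  obtain ⟨ρ, hρ, H⟩ := Metric.continuousAt_iff.1 ch δ hδ
  refine ⟨ρ, hρ, fun u hu => ?_⟩
  have := H hu
  rw [h0, Real.dist_eq, sub_zero, hh] at this
  exact (le_abs_self _).trans_lt this

end ModelPlane

section Grid
variable {X : Type*} [MetricSpace X]

/-- Coordinates on `A` whose coordinate lines are isometric to subsets of the real line. -/
structure IsGridOn (A : Set X) (k : X → ℝ × ℝ) : Prop where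
  exists_lt : ∀ x₀ ∈ A, ∀ δ > 0, ∃ ρ > 0, ∀ x ∈ A, dist x x₀ < ρ → dist (k x) (k x₀) < δ
  exists_dist_lt : ∀ x₀ ∈ A, ∀ δ > 0, ∃ ρ > 0, ∀ x ∈ A, dist (k x) (k x₀) < ρ → dist x x₀ < δ
  fst_line : ∃ w : X → ℝ, ∀ x ∈ A, ∀ x' ∈ A, (k x).1 = (k x').1 → dist x x' = |w x - w x'|
  snd_line : ∃ w : X → ℝ, ∀ x ∈ A, ∀ x' ∈ A, (k x).2 = (k x').2 → dist x x' = |w x - w x'|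

lemma exists_isGridOn {κ : ℝ} (hκ : κ ≤ 0) {A : Set X} {f : X → ℝ × ℝ}
    (hf : ∀ x ∈ A, ∀ y ∈ A, mDist κ (f x) (f y) = dist x y) : ∃ k, IsGridOn A k := by
  rcases hκ.lt_or_eq with hκ | rfl
  · refine ⟨fun x => klein (f x), ?_, ?_,
      ⟨fun x => 1 / Real.sqrt (-κ) * Real.arsinh (f x).2, fun x hx x' hx' h => ?_⟩,
      ⟨fun x => 1 / Real.sqrt (-κ) * Real.arsinh (f x).1, fun x hx x' hx' h => ?_⟩⟩
    · intro x₀ h₀ δ hδ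
      have hc : ContinuousAt (fun t => Real.sinh (Real.sqrt (-κ) * t)) 0 := by
        have := Real.continuous_sinh
        fun_prop
      obtain ⟨ρ, hρ, H⟩ := Metric.continuousAt_iff.1 hc δ hδ
      refine ⟨ρ, hρ, fun x hx hlt => (dist_klein_le hκ _ _).trans_lt ?_⟩
      rw [hf x hx x₀ h₀]
      have := @H (dist x x₀) (by simpa [Real.dist_eq] using hlt)
      simp only [mul_zero, Real.sinh_zero, Real.dist_eq, sub_zero] at this
      exact (le_abs_self _).trans_lt this
    · intro x₀ h₀ δ hδ
      obtain ⟨ρ, hρ, H⟩ := exists_mDist_lt_of_klein hκ (f x₀) hδ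
      exact ⟨ρ, hρ, fun x hx h => hf x hx x₀ h₀ ▸ H _ h⟩
    · rw [← hf x hx x' hx']
      exact mDist_of_klein_fst hκ h
    · rw [← hf x hx x' hx']
      exact mDist_of_klein_snd hκ h
  · have e (x) (hx : x ∈ A) (y) (hy : y ∈ A) :
        dist x y = Real.sqrt (((f x).1 - (f y).1) ^ 2 + ((f x).2 - (f y).2) ^ 2) := by
      rw [← hf x hx y hy, mDist, if_pos rfl]
    refine ⟨f, ?_, ?_, ⟨fun x => (f x).2, fun x hx x' hx' h => ?_⟩,
      ⟨fun x => (f x).1, fun x hx x' hx' h => ?_⟩⟩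
    · intro x₀ h₀ δ hδ
      refine ⟨δ, hδ, fun x hx hlt => lt_of_le_of_lt ?_ hlt⟩
      rw [e x hx x₀ h₀, Prod.dist_eq, Real.dist_eq, Real.dist_eq]
      refine max_le (Real.abs_le_sqrt ?_) (Real.abs_le_sqrt ?_)
      · nlinarith [sq_nonneg ((f x).2 - (f x₀).2)]
      · nlinarith [sq_nonneg ((f x).1 - (f x₀).1)]
    · intro x₀ h₀ δ hδ
      refine ⟨δ / 2, by positivity, fun x hx hlt => ?_⟩
      rw [Prod.dist_eq, Real.dist_eq, Real.dist_eq, max_lt_iff] at hlt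
      rw [e x hx x₀ h₀, Real.sqrt_lt' hδ, ← sq_abs ((f x).1 - _), ← sq_abs ((f x).2 - _)]
      nlinarith [abs_nonneg ((f x).1 - (f x₀).1), abs_nonneg ((f x).2 - (f x₀).2)]
    · rw [e x hx x' hx', h, sub_self, zero_pow two_ne_zero, zero_add, Real.sqrt_sq_eq_abs]
    · rw [e x hx x' hx', h, sub_self, zero_pow two_ne_zero, add_zero, Real.sqrt_sq_eq_abs]

lemma IsGridOn.continuousOn {A : Set X} {k : X → ℝ × ℝ} (h : IsGridOn A k) :
    ContinuousOn k A := Metric.continuousOn_iff.2 fun b hb ε hε => by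
  simpa using h.exists_lt b hb ε hε

/-- Small squares of a grid have small diameter, uniformly near a compact set. -/
lemma IsGridOn.exists_uniform {A L : Set X} {k : X → ℝ × ℝ} (h : IsGridOn A k)
    (hA : IsClosed A) (hL : IsCompact L) {δ : ℝ} (hδ : 0 < δ) :
    ∃ ρ > 0, ∀ x ∈ A, ∀ y ∈ A ∩ L, dist (k x) (k y) < ρ → dist x y < δ := by
  by_contra! H
  choose! x hx y hy hlt hle using fun n : ℕ => H (1 / (n + 1 : ℝ)) Nat.one_div_pos_of_nat
  have hK : IsCompact (A ∩ L) := hL.inter_left hA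
  obtain ⟨z, hz, φ, hφ, hlim⟩ := hK.tendsto_subseq hy
  obtain ⟨ρ, hρ, hρ'⟩ := h.exists_dist_lt z hz.1 (δ / 2) (half_pos hδ)
  obtain ⟨ρ₂, hρ₂, hρ₂'⟩ := h.exists_lt z hz.1 (ρ / 2) (half_pos hρ)
  have h0 : Tendsto (fun n => 1 / ((φ n : ℝ) + 1)) atTop (nhds 0) :=
    tendsto_one_div_add_atTop_nhds_zero_nat.comp hφ.tendsto_atTop
  obtain ⟨n, hn1, hn2, hn3⟩ := ((Metric.tendsto_nhds.1 hlim (δ / 2) (half_pos hδ)).and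
    ((Metric.tendsto_nhds.1 hlim ρ₂ hρ₂).and (h0.eventually_lt_const (half_pos hρ)))).exists
  have h1 : dist (k (x (φ n))) (k z) < ρ := by
    have := dist_triangle (k (x (φ n))) (k (y (φ n))) (k z)
    have := hρ₂' _ (hy (φ n)).1 hn2
    have := hlt (φ n)
    linarith
  have := hρ' _ (hx (φ n)) h1
  have := dist_triangle_right (x (φ n)) (y (φ n)) z
  have := hle (φ n)
  simp only [Function.comp] at hn1
  linarith

variable [CATZero X]

/-- A sphere meets a subset of a geodesic line in finitely many points. -/
lemma finite_of_line {T : Set X} {y : X} {r : ℝ} (hT : T ⊆ sphere y r) {w : X → ℝ}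
    (hw : ∀ x ∈ T, ∀ x' ∈ T, dist x x' = |w x - w x'|) : T.Finite := by
  classical
  by_contra hinf
  obtain ⟨t, htT, ht⟩ := Set.Infinite.exists_subset_card_eq hinf 3
  have key : ∀ a ∈ T, ∀ b ∈ T, ∀ c ∈ T, a ≠ b → b ≠ c → w a ≤ w b → w b ≤ w c → False := by
    intro a ha b hb c hc hab hbc h1 h2
    refine not_equidistant_of_between hab hbc ?_ (hT ha) (hT hb) (hT hc)
    rw [hw a ha b hb, hw b hb c hc, hw a ha c hc, abs_of_nonpos (by linarith),
      abs_of_nonpos (by linarith), abs_of_nonpos (by linarith)]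
    ring
  obtain ⟨a, b, c, hab, hac, hbc, rfl⟩ := Finset.card_eq_three.1 ht
  have ha : a ∈ T := htT (by simp)
  have hb : b ∈ T := htT (by simp)
  have hc : c ∈ T := htT (by simp)
  rcases le_total (w a) (w b) with h1 | h1 <;> rcases le_total (w b) (w c) with h2 | h2 <;>
    rcases le_total (w a) (w c) with h3 | h3
  · exact key a ha b hb c hc hab hbc h1 h2
  · exact key a ha b hb c hc hab hbc h1 h2
  · exact key a ha c hc b hb hac hbc.symm h3 h2
  · exact key c hc a ha b hb hac.symm hab h3 h1
  · exact key b hb a ha c hc hab.symm hac h1 h3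
  · exact key b hb c hc a ha hbc hac.symm h2 h3
  · exact key c hc b hb a ha hbc.symm hab.symm h2 h1
  · exact key c hc b hb a ha hbc.symm hab.symm h2 h1

end Grid

section SphereDecomposition
variable {X : Type*} [MetricSpace X]

/-- A compact set has a neighbourhood meeting only finitely many cells and vertices. -/
lemma PolyComplex2.exists_nhds_finite {κ : ℝ} (PC : PolyComplex2 κ X) {L : Set X}
    (hL : IsCompact L) : ∃ U, IsOpen U ∧ L ⊆ U ∧
      {c | (c ∈ PC.faces ∨ c ∈ PC.edges) ∧ (c ∩ U).Nonempty}.Finite ∧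
      (PC.vertices ∩ U).Finite := by
  choose r hr hc hv using PC.locally_finite
  obtain ⟨t, -, ht⟩ := hL.elim_nhds_subcover (fun x => ball x (r x))
    fun x _ => ball_mem_nhds x (hr x)
  refine ⟨⋃ x ∈ t, ball x (r x), isOpen_biUnion fun _ _ => isOpen_ball, ht, ?_, ?_⟩
  · refine (t.finite_toSet.biUnion fun x _ => hc x).subset ?_
    rintro c ⟨hcell, z, hzc, hz⟩
    obtain ⟨x, hx, hzx⟩ := mem_iUnion₂.1 hz
    exact mem_iUnion₂.2 ⟨x, hx, hcell, z, hzc, hzx⟩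
  · rw [inter_iUnion₂]
    exact t.finite_toSet.biUnion fun x _ => hv x

variable [CATZero X]

lemma PolyComplex2.finite_edge_inter_sphere {κ : ℝ} (PC : PolyComplex2 κ X) {e : Set X}
    (he : e ∈ PC.edges) (y : X) (ε : ℝ) : (e ∩ sphere y ε).Finite := by
  obtain ⟨f, l, -, ⟨-, hf⟩, rfl⟩ := PC.edge_geodesic e he
  choose! w hw using fun x (hx : x ∈ f '' Ioo 0 l) => hx
  refine finite_of_line (w := w) inter_subset_right fun x hx x' hx' => ?_
  obtain ⟨h1, hfw⟩ := hw x hx.1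
  obtain ⟨h1', hfz⟩ := hw x' hx'.1
  have h := hf _ (Ioo_subset_Icc_self h1) _ (Ioo_subset_Icc_self h1')
  rwa [hfw, hfz] at h

/-- Coordinates on a closed face whose unit squares meeting `L` are small and whose coordinate
lines meet a given sphere in finitely many points. -/
lemma PolyComplex2.exists_coordinates {κ : ℝ} (hκ : κ ≤ 0) (PC : PolyComplex2 κ X) {F : Set X}
    (hF : F ∈ PC.faces) (y : X) (ε : ℝ) {L : Set X} (hL : IsCompact L) {δ : ℝ} (hδ : 0 < δ) :
    ∃ (g : X → ℝ × ℝ) (N : ℤ), ContinuousOn g (closure F) ∧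
      (∀ x ∈ closure F, ∀ z ∈ closure F ∩ L, dist (g x) (g z) < 1 → dist x z < δ) ∧
      (∀ c, {x ∈ closure F ∩ sphere y ε | (g x).1 = c ∨ (g x).2 = c}.Finite) ∧
      ∀ x ∈ closure F ∩ L, ⌊(g x).1⌋ ∈ Icc (-N) N ∧ ⌊(g x).2⌋ ∈ Icc (-N) N := by
  obtain ⟨f, P, -, -, -, -, hf⟩ := PC.face_chart F hF
  obtain ⟨k, hk⟩ := exists_isGridOn hκ hf
  obtain ⟨ρ, hρ, hu⟩ := hk.exists_uniform isClosed_closure hL hδ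
  have hc : ContinuousOn (fun x => ρ⁻¹ • k x) (closure F) :=
    hk.continuousOn.const_smul ρ⁻¹
  obtain ⟨C, hC⟩ := (hL.inter_left isClosed_closure).exists_bound_of_continuousOn
    (hc.mono inter_subset_left)
  have hfl : ∀ s : ℝ, |s| ≤ C → ⌊s⌋ ∈ Icc (-⌈C + 1⌉) ⌈C + 1⌉ := by
    intro s hs
    have h1 := abs_le.1 hs
    have h2 := Int.le_ceil (C + 1)
    have h3 := Int.floor_le s
    have h4 := Int.lt_floor_add_one s
    constructor
    · have : ((-⌈C + 1⌉ : ℤ) : ℝ) ≤ ⌊s⌋ := by push_cast; linarith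
      exact_mod_cast this
    · have : ((⌊s⌋ : ℤ) : ℝ) ≤ ⌈C + 1⌉ := by linarith
      exact_mod_cast this
  refine ⟨fun x => ρ⁻¹ • k x, ⌈C + 1⌉, hc, fun x hx z hz h => hu x hx z hz ?_, fun c => ?_,
    fun x hx => ⟨hfl _ ((norm_fst_le _).trans (hC x hx)), hfl _ ((norm_snd_le _).trans (hC x hx))⟩⟩
  · rw [dist_smul₀, Real.norm_of_nonneg (inv_nonneg.2 hρ.le)] at h
    rwa [inv_mul_lt_iff₀ hρ, mul_one] at h
  · obtain ⟨w₁, hw₁⟩ := hk.fst_line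
    obtain ⟨w₂, hw₂⟩ := hk.snd_line
    have h1 : {x ∈ closure F ∩ sphere y ε | (ρ⁻¹ • k x).1 = c}.Finite :=
      finite_of_line (w := w₁) (fun x hx => hx.1.2) fun x hx x' hx' =>
        hw₁ x hx.1.1 x' hx'.1.1 (by
          have := hx.2.trans hx'.2.symm
          simpa [hρ.ne'] using this)
    have h2 : {x ∈ closure F ∩ sphere y ε | (ρ⁻¹ • k x).2 = c}.Finite :=
      finite_of_line (w := w₂) (fun x hx => hx.1.2) fun x hx x' hx' =>
        hw₂ x hx.1.1 x' hx'.1.1 (by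
          have := hx.2.trans hx'.2.symm
          simpa [hρ.ne'] using this)
    refine (h1.union h2).subset ?_
    rintro x ⟨hx, h | h⟩
    exacts [Or.inl ⟨hx, h⟩, Or.inr ⟨hx, h⟩]

theorem PolyComplex2.hasSphereDecomposition {κ : ℝ} (hκ : κ ≤ 0) (PC : PolyComplex2 κ X) :
    HasSphereDecomposition X := by
  intro y ε hε L hL hLS δ hδ
  obtain ⟨U, hU, hLU, hcells, hverts⟩ := PC.exists_nhds_finite hL
  obtain ⟨δ₀, hδ₀, hthick⟩ := hL.exists_thickening_subset_open hU hLU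
  obtain ⟨δ₁, hδ₁, hδ₁', hδ₁''⟩ : ∃ δ₁ > 0, δ₁ ≤ δ / 2 ∧ δ₁ < δ₀ :=
    ⟨min (δ / 2) (δ₀ / 2), by positivity, min_le_left _ _,
      (min_le_right _ _).trans_lt (half_lt_self hδ₀)⟩
  choose! g N hg hsmall hline hfloor using fun (F : Set X) (hF : F ∈ PC.faces) =>
    PC.exists_coordinates hκ hF y ε hL hδ₁
  let piece : Set X × ℤ × ℤ → Set X := fun a => {x ∈ a.1 ∩ sphere y ε |
    (g a.1 x).1 ∈ Ioo (a.2.1 : ℝ) (a.2.1 + 1) ∧ (g a.1 x).2 ∈ Ioo (a.2.2 : ℝ) (a.2.2 + 1)}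
  let I : Set (Set X × ℤ × ℤ) := {a | a.1 ∈ PC.faces ∧ (piece a ∩ L).Nonempty}
  have hfaces : {F | F ∈ PC.faces ∧ (F ∩ L).Nonempty}.Finite :=
    hcells.subset fun F hF => ⟨Or.inl hF.1, hF.2.mono (inter_subset_inter_right _ hLU)⟩
  have hflo {s : ℝ} {m : ℤ} (h : s ∈ Ioo (m : ℝ) (m + 1)) : ⌊s⌋ = m :=
    Int.floor_eq_iff.2 ⟨h.1.le, h.2⟩
  have hI : I.Finite := by
    refine (hfaces.biUnion fun F _ => ((finite_singleton F).prod
      ((finite_Icc (-N F) (N F)).prod (finite_Icc (-N F) (N F))))).subset ?_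
    rintro ⟨F, m, n⟩ ⟨hF, x, ⟨⟨hxF, hxS⟩, h1, h2⟩, hxL⟩
    refine mem_iUnion₂.2 ⟨F, ⟨hF, x, hxF, hxL⟩, rfl, ?_⟩
    have := hfloor F hF x ⟨subset_closure hxF, hxL⟩
    rwa [hflo h1, hflo h2] at this
  let Λ : Set X := ⋃ F ∈ {F | F ∈ PC.faces ∧ (F ∩ L).Nonempty}, ⋃ m ∈ Icc (-N F) (N F + 1),
    {x ∈ closure F ∩ sphere y ε | (g F x).1 = m ∨ (g F x).2 = m}
  have hΛ : Λ.Finite := hfaces.biUnion fun F hF => (finite_Icc _ _).biUnion fun m _ =>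
    hline F hF.1 m
  let Ed : Set X := ⋃ e ∈ {e | e ∈ PC.edges ∧ (e ∩ U).Nonempty}, e ∩ sphere y ε
  have hEd : Ed.Finite := (hcells.subset fun e he => ⟨Or.inr he.1, he.2⟩).biUnion fun e he =>
    PC.finite_edge_inter_sphere he.1 y ε
  have hskel {x : X} (hxS : x ∈ sphere y ε) (hxU : x ∈ U) (hx : x ∈ ⋃₀ PC.edges ∪ PC.vertices) :
      x ∈ Λ ∪ Ed ∪ (PC.vertices ∩ U) := by
    rcases hx with ⟨e, he, hxe⟩ | hx
    · exact Or.inl (Or.inr (mem_iUnion₂.2 ⟨e, ⟨he, x, hxe, hxU⟩, hxe, hxS⟩))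
    · exact Or.inr ⟨hx, hxU⟩
  have hclose {a : Set X × ℤ × ℤ} (ha : a ∈ I) : ∃ z ∈ L, ∀ x ∈ piece a, dist x z < δ₁ := by
    obtain ⟨hF, z, hz, hzL⟩ := ha
    refine ⟨z, hzL, fun x hx => hsmall a.1 hF x (subset_closure hx.1.1) z
      ⟨subset_closure hz.1.1, hzL⟩ ?_⟩
    rw [Prod.dist_eq, Real.dist_eq, Real.dist_eq]
    refine max_lt (abs_lt.2 ⟨?_, ?_⟩) (abs_lt.2 ⟨?_, ?_⟩)
    · linarith [hx.2.1.1, hz.2.1.2]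
    · linarith [hx.2.1.2, hz.2.1.1]
    · linarith [hx.2.2.1, hz.2.2.2]
    · linarith [hx.2.2.2, hz.2.2.1]
  have hbdry {a : Set X × ℤ × ℤ} (ha : a ∈ I) :
      closure (piece a) \ piece a ⊆ Λ ∪ Ed ∪ (PC.vertices ∩ U) := by
    rintro x ⟨hxc, hx⟩
    have hxS : x ∈ sphere y ε :=
      closure_minimal (fun z hz => hz.1.2) isClosed_sphere hxc
    have hxF : x ∈ closure a.1 := closure_mono (fun z hz => hz.1.1) hxc
    have hxU : x ∈ U := by
      obtain ⟨z, hz, H⟩ := hclose ha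
      have hle : x ∈ closedBall z δ₁ :=
        closure_minimal (fun w hw => mem_closedBall.2 (H w hw).le) isClosed_closedBall hxc
      exact hthick (mem_thickening_iff.2 ⟨z, hz, (mem_closedBall.1 hle).trans_lt hδ₁''⟩)
    by_cases hxF' : x ∈ a.1
    swap
    · exact hskel hxS hxU (PC.face_closure a.1 ha.1 ⟨hxF, hxF'⟩)
    have himg : g a.1 x ∈ Icc (a.2.1 : ℝ) (a.2.1 + 1) ×ˢ Icc (a.2.2 : ℝ) (a.2.2 + 1) := by
      have h1 := ((hg a.1 ha.1).mono (closure_mono fun z hz => hz.1.1)).image_closure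
        (mem_image_of_mem _ hxc)
      refine closure_minimal ?_ (isClosed_Icc.prod isClosed_Icc) h1
      rintro _ ⟨z, hz, rfl⟩
      exact ⟨Ioo_subset_Icc_self hz.2.1, Ioo_subset_Icc_self hz.2.2⟩
    obtain ⟨hF, z, hz, hzL⟩ := ha
    have hfl := hfloor a.1 hF z ⟨subset_closure hz.1.1, hzL⟩
    rw [hflo hz.2.1, hflo hz.2.2] at hfl
    have hmem (m : ℤ) (hm : m ∈ Icc (-N a.1) (N a.1 + 1))
        (h : (g a.1 x).1 = m ∨ (g a.1 x).2 = m) : x ∈ Λ ∪ Ed ∪ (PC.vertices ∩ U) :=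
      Or.inl (Or.inl (mem_iUnion₂.2 ⟨a.1, ⟨hF, z, hz.1.1, hzL⟩,
        mem_iUnion₂.2 ⟨m, hm, ⟨hxF, hxS⟩, h⟩⟩))
    simp only [mem_Icc] at hfl hmem
    by_contra hcon
    refine hx ⟨⟨hxF', hxS⟩, ⟨himg.1.1.lt_of_ne fun h => ?_, himg.1.2.lt_of_ne fun h => ?_⟩,
      ⟨himg.2.1.lt_of_ne fun h => ?_, himg.2.2.lt_of_ne fun h => ?_⟩⟩
    · exact hcon (hmem a.2.1 (by omega) (Or.inl h.symm))
    · exact hcon (hmem (a.2.1 + 1) (by omega) (Or.inl (by push_cast; exact h)))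
    · exact hcon (hmem a.2.2 (by omega) (Or.inr h.symm))
    · exact hcon (hmem (a.2.2 + 1) (by omega) (Or.inr (by push_cast; exact h)))
  have hdisj {a b : Set X × ℤ × ℤ} (ha : a ∈ I) (hb : b ∈ I) (hab : a ≠ b) :
      Disjoint (piece a) (piece b) := by
    rw [Set.disjoint_left]
    intro x hxa hxb
    have hF : a.1 = b.1 := by
      by_contra hne
      have := PC.cells_disjoint a.1 (Or.inl ha.1) b.1 (Or.inl hb.1) hne
      exact (this ▸ ⟨hxa.1.1, hxb.1.1⟩ : x ∈ (∅ : Set X))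
    have h1 := hxa.2
    rw [hF] at h1
    exact hab (Prod.ext hF (Prod.ext ((hflo h1.1).symm.trans (hflo hxb.2.1))
      ((hflo h1.2).symm.trans (hflo hxb.2.2))))
  have hopen {a : Set X × ℤ × ℤ} (ha : a ∈ I) : ∃ G, IsOpen G ∧ piece a = G ∩ sphere y ε := by
    refine ⟨a.1 ∩ g a.1 ⁻¹' (Ioo (a.2.1 : ℝ) (a.2.1 + 1) ×ˢ Ioo (a.2.2 : ℝ) (a.2.2 + 1)),
      ((hg a.1 ha.1).mono subset_closure).isOpen_inter_preimage (PC.faces_open _ ha.1)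
        (isOpen_Ioo.prod isOpen_Ioo), ?_⟩
    ext x
    exact ⟨fun h => ⟨⟨h.1.1, h.2⟩, h.1.2⟩, fun h => ⟨⟨h.1.1, h.2⟩, h.1.2⟩⟩
  have hcover : L \ ⋃ a ∈ I, piece a ⊆ Λ ∪ Ed ∪ (PC.vertices ∩ U) := by
    rintro x ⟨hxL, hx⟩
    have hcov : x ∈ ⋃₀ PC.faces ∪ ⋃₀ PC.edges ∪ PC.vertices := PC.cover ▸ mem_univ x
    rw [union_assoc] at hcov
    rcases hcov with ⟨F, hF, hxF⟩ | hcov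
    swap
    · exact hskel (hLS hxL) (hLU hxL) hcov
    have hfl := hfloor F hF x ⟨subset_closure hxF, hxL⟩
    have hmem (m : ℤ) (hm : m ∈ Icc (-N F) (N F))
        (h : (g F x).1 = m ∨ (g F x).2 = m) : x ∈ Λ ∪ Ed ∪ (PC.vertices ∩ U) :=
      Or.inl (Or.inl (mem_iUnion₂.2 ⟨F, ⟨hF, x, hxF, hxL⟩,
        mem_iUnion₂.2 ⟨m, ⟨hm.1, hm.2.trans (by omega)⟩, ⟨subset_closure hxF, hLS hxL⟩, h⟩⟩))
    by_contra hcon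
    have hp : x ∈ piece (F, ⌊(g F x).1⌋, ⌊(g F x).2⌋) :=
      ⟨⟨hxF, hLS hxL⟩,
        ⟨(Int.floor_le _).lt_of_ne fun h => hcon (hmem _ hfl.1 (Or.inl h.symm)),
          Int.lt_floor_add_one _⟩,
        ⟨(Int.floor_le _).lt_of_ne fun h => hcon (hmem _ hfl.2 (Or.inr h.symm)),
          Int.lt_floor_add_one _⟩⟩
    exact hx (mem_iUnion₂.2 ⟨_, ⟨hF, x, hp, hxL⟩, hp⟩)
  have := hI.to_subtype
  obtain ⟨n, ⟨e⟩⟩ := Finite.exists_equiv_fin I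
  refine ⟨(⋃ a ∈ I, closure (piece a) \ piece a) ∪ (L \ ⋃ a ∈ I, piece a), n,
    fun i => piece (e.symm i).1, ?_, fun i => hopen (e.symm i).2, fun i j hij => ?_, fun i => ?_,
    fun i a ha b hb => ?_, fun i => (e.symm i).2.2, fun i x hx => ?_, fun x hx => ?_⟩
  · exact ((hΛ.union hEd).union hverts).subset
      (union_subset (iUnion₂_subset fun a ha => hbdry ha) hcover)
  · exact hdisj (e.symm i).2 (e.symm j).2 fun h => hij (e.symm.injective (Subtype.ext h))
  · rw [Set.disjoint_left]
    intro x hx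
    change x ∈ piece (e.symm i).1 at hx
    rintro (hx' | hx')
    · obtain ⟨b, hb, hxb, hxb'⟩ := mem_iUnion₂.1 hx'
      obtain ⟨G, hG, hGe⟩ := hopen (e.symm i).2
      obtain ⟨z, hzG, hz⟩ := mem_closure_iff.1 hxb G hG (hGe ▸ hx).1
      have hne : (e.symm i).1 ≠ b := by rintro rfl; exact hxb' hx
      exact Set.disjoint_left.1 (hdisj (e.symm i).2 hb hne) (hGe ▸ ⟨hzG, hz.1.2⟩) hz
    · exact hx'.2 (mem_iUnion₂.2 ⟨_, (e.symm i).2, hx⟩)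
  · obtain ⟨z, -, H⟩ := hclose (e.symm i).2
    linarith [dist_triangle_right a b z, H a ha, H b hb]
  · by_cases h : x ∈ piece (e.symm i).1
    · exact Or.inl h
    · exact Or.inr (Or.inl (mem_iUnion₂.2 ⟨_, (e.symm i).2, hx, h⟩))
  · by_cases h : x ∈ ⋃ a ∈ I, piece a
    · obtain ⟨a, ha, hxa⟩ := mem_iUnion₂.1 h
      refine Or.inr (mem_iUnion.2 ⟨e ⟨a, ha⟩, ?_⟩)
      simpa using hxa
    · exact Or.inl (Or.inr ⟨hx, h⟩)

end SphereDecomposition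

section Extension
open Topology
variable {X : Type*} [MetricSpace X] [CATZero X]

/-- A geodesic ending in the interior of `γ` can be prolonged, staying `ε`-close to the interior,
until it is `ε`-close to `γ`. -/
lemma SCC.exists_approximate_extension (γ : SCC X) (hdec : HasSphereDecomposition X) (p : X)
    {q : X} (hq : q ∈ γ.interiorSet) {ε : ℝ} (hε : 0 < ε) :
    ∃ y ∈ γ.interiorSet, dist p y = dist p q + dist q y ∧
      (∀ w, dist q w + dist w y = dist q y → ∃ a ∈ γ.interiorSet, dist w a ≤ ε) ∧
      ∃ x ∈ γ.img, dist y x ≤ ε := by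
  let R : Set X := {y | y ∈ γ.interiorSet ∧ dist p y = dist p q + dist q y ∧
    ∀ w, dist q w + dist w y = dist q y → ∃ a ∈ γ.interiorSet, dist w a ≤ ε}
  have hqR : q ∈ R := by
    refine ⟨hq, by simp, fun w hw => ⟨q, hq, ?_⟩⟩
    rw [dist_self] at hw
    linarith [dist_nonneg (x := q) (y := w)]
  obtain ⟨K, hK, hsub⟩ := γ.exists_isCompact_interiorSet_subset
  have hbdd : BddAbove (dist p '' R) := by
    refine (hK.image (f := dist p) (by fun_prop)).bddAbove.mono ?_
    exact image_mono fun y hy => hsub hy.1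
  obtain ⟨_, ⟨y, hy, rfl⟩, hlt⟩ := exists_lt_of_lt_csSup (⟨_, q, hqR, rfl⟩ : (dist p '' R).Nonempty)
    (sub_lt_self (sSup (dist p '' R)) hε)
  refine ⟨y, hy.1, hy.2.1, hy.2.2, ?_⟩
  by_contra! hγ
  obtain ⟨z, hz, hyz, hpz⟩ := γ.exists_further_interior_point hdec p hy.1 hε hγ
  have h1 := hy.2.1
  have h2 := dist_triangle q y z
  have h3 := dist_triangle p q z
  have hzR : z ∈ R := by
    refine ⟨hz, by linarith, fun w hw => ?_⟩
    rcases le_total (dist q w) (dist q y) with h | h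
    · exact hy.2.2 w (between_of_between hw (by linarith) h)
    · exact ⟨z, hz, by linarith⟩
  have := le_csSup hbdd ⟨z, hzR, rfl⟩
  linarith

/-- A geodesic ending in the interior of `γ` can be prolonged inside the closure of the interior
up to a point of `γ`. -/
lemma SCC.exists_extension (γ : SCC X) (hdec : HasSphereDecomposition X) (p : X)
    {q : X} (hq : q ∈ γ.interiorSet) :
    ∃ z ∈ γ.img, dist p z = dist p q + dist q z ∧
      ∀ t, geo q z t ∈ γ.img ∪ γ.interiorSet := by
  choose y hy hpy hclose x hx hyx using fun n : ℕ =>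
    γ.exists_approximate_extension hdec p hq (Nat.one_div_pos_of_nat (α := ℝ) (n := n))
  obtain ⟨z, hz, φ, hφ, hlim⟩ := γ.isCompact_img.tendsto_subseq hx
  have h0 : Tendsto (fun n => 1 / ((φ n : ℝ) + 1)) atTop (𝓝 0) :=
    tendsto_one_div_add_atTop_nhds_zero_nat.comp hφ.tendsto_atTop
  have hylim : Tendsto (y ∘ φ) atTop (𝓝 z) :=
    (tendsto_iff_of_dist (squeeze_zero (fun _ => dist_nonneg) (fun n => hyx (φ n)) h0)).2 hlim
  refine ⟨z, hz, ?_, fun t => ?_⟩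
  · refine tendsto_nhds_unique (tendsto_const_nhds.dist hylim) ?_
    simp only [Function.comp, hpy]
    exact tendsto_const_nhds.add (tendsto_const_nhds.dist hylim)
  · choose a ha hda using fun n => hclose (φ n) (geo q (y (φ n)) t) (dist_geo_add _ _ _)
    have hglim : Tendsto (fun n => geo q (y (φ n)) t) atTop (𝓝 (geo q z t)) :=
      ((Continuous.geo' continuous_const continuous_id continuous_const).tendsto z).comp hylim
    have halim : Tendsto a atTop (𝓝 (geo q z t)) :=
      (tendsto_iff_of_dist (squeeze_zero (fun _ => dist_nonneg) hda h0)).1 hglim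
    exact γ.isClosed_img_union_interiorSet.mem_of_tendsto halim
      (Eventually.of_forall fun n => Or.inr (ha n))

/-- A geodesic ending in the interior of `γ` can be prolonged inside the interior until it first
hits `γ`. -/
lemma SCC.exists_extension_to_curve (γ : SCC X) (hdec : HasSphereDecomposition X) (p : X)
    {q : X} (hq : q ∈ γ.interiorSet) :
    ∃ q' ∈ γ.img, dist p q' = dist p q + dist q q' ∧
      ∀ w, dist q w + dist w q' = dist q q' → w ≠ q' → w ∈ γ.interiorSet := by
  obtain ⟨z, hz, hpz, hgeo⟩ := γ.exists_extension hdec p hq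
  have hcont : Continuous fun t => geo q z t :=
    Continuous.geo' continuous_const continuous_const continuous_id
  have hT : IsCompact (Icc (0 : ℝ) 1 ∩ (fun t => geo q z t) ⁻¹' γ.img) :=
    isCompact_Icc.inter_right (γ.isCompact_img.isClosed.preimage hcont)
  obtain ⟨t₀, ⟨ht₀, hmem⟩, hmin⟩ := hT.exists_isLeast ⟨1, by simp, by simpa [geo_one] using hz⟩
  have hbet := dist_geo_add q z t₀
  have h1 := dist_triangle p q (geo q z t₀)
  have h2 := dist_triangle p (geo q z t₀) z
  refine ⟨geo q z t₀, hmem, by linarith, fun w hw hne => ?_⟩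
  have hwz : dist q w + dist w z = dist q z := by
    linarith [dist_triangle q w z, dist_triangle w (geo q z t₀) z]
  obtain ⟨t, ht, rfl⟩ := exists_geo_eq hwz
  refine (hgeo t).resolve_left fun hγ => hne ?_
  have hle := hmin ⟨ht, hγ⟩
  have e1 := dist_left_geo q z t
  have e2 := dist_left_geo q z t₀
  rw [clamp_of_mem ht] at e1
  rw [clamp_of_mem ht₀] at e2
  have h3 : dist q (geo q z t₀) ≤ dist q (geo q z t) := by
    rw [e1, e2]; exact mul_le_mul_of_nonneg_right hle dist_nonneg
  exact dist_le_zero.1 (by linarith)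

end Extension

end Cat2Cx

open Cat2Cx in
/-- **Corollary (curve_theorem_2).**  Let `γ` be a simple closed curve in `X`.  Then `Int γ`
extends geodesics to `γ`: every `X`-geodesic `[p,q]_X ⊆ Int γ` extends to an `X`-geodesic
`[p,q']_X` with `[p,q]_X ⊆ [p,q']_X ⊆ γ ∪ Int γ`, `q' ∈ γ`, and `[p,q']_X \ {q'} ⊆ Int γ`. -/
theorem interiorSet_extends_geodesics_to_curve
    {κ : ℝ} (hκ : κ ≤ 0) {X : Type*} [MetricSpace X]
    (PC : PolyComplex2 κ X) (hX : IsCATSpace κ X)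
    (γ : SCC X) (p q : X) (hpq : p ≠ q)
    (hsub : geodSeg (xDist X) Set.univ p q ⊆ γ.interiorSet) :
    ∃ q' : X, q' ∈ γ.img ∧
      geodSeg (xDist X) Set.univ p q ⊆ geodSeg (xDist X) Set.univ p q' ∧
      geodSeg (xDist X) Set.univ p q' ⊆ γ.img ∪ γ.interiorSet ∧
      geodSeg (xDist X) Set.univ p q' \ {q'} ⊆ γ.interiorSet := by
  have := hX.catZero hκ
  have hseg := mem_geodSeg_iff hX
  have hq : q ∈ γ.interiorSet := hsub ((hseg p q q).2 (by simp))
  obtain ⟨q', hq', hpq', hmem_int⟩ :=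
    γ.exists_extension_to_curve (PC.hasSphereDecomposition hκ) p hq
  have key : geodSeg (xDist X) Set.univ p q' \ {q'} ⊆ γ.interiorSet := by
    rintro w ⟨hw, hne⟩
    rw [hseg] at hw
    rcases le_total (dist p w) (dist p q) with h | h
    · exact hsub ((hseg p q w).2 (between_of_between hw hpq'.symm h))
    · refine hmem_int w ?_ hne
      have hwq : dist q' w + dist w q = dist q' q := by
        refine between_of_between (y' := p) ?_ ?_ ?_ <;>
          simp only [dist_comm q', dist_comm w p, dist_comm q p] <;> linarith
      rw [dist_comm q w, dist_comm w q', dist_comm q q']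
      linarith
  refine ⟨q', hq', fun w hw => ?_, fun w hw => ?_, key⟩
  · rw [hseg] at hw ⊢
    linarith [dist_triangle p w q', dist_triangle w q q']
  · by_cases h : w = q'
    · exact Or.inl (h ▸ hq')
    · exact Or.inr (key ⟨hw, h⟩)
end

section
/- Let γ be a simple closed curve contained in E, and let α be a subarc of γ that is a geodesic in Y. If x, y ∈ α are such that the X-geodesic [x,y]_X lies in γ ∪ Int γ, then [x,y]_X ⊆ α. -/
open Set Metric Filter

namespace Cat2Cx

/-! ### Interiors of curves in sets with vanishing first homology -/

/-- The first homology class of a loop is natural with respect to continuous maps. -/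
theorem loopClassH1_map {A B : Type*} [TopologicalSpace A] [TopologicalSpace B] {a : A}
    (p : Path a a) (f : C(A, B)) :
    loopClassH1 (p.map f.continuous) =
      Abelianization.map (FundamentalGroup.map f a) (loopClassH1 p) := by
  rfl

theorem SCC.NullhomologousIn.mono {X : Type*} [TopologicalSpace X] {γ : SCC X} {A B : Set X}
    (hA : γ.NullhomologousIn A) (hγ : γ.img ⊆ A) (hAB : A ⊆ B) : γ.NullhomologousIn B := by
  intro h
  have key := loopClassH1_map (γ.pathIn A hγ) ⟨Set.inclusion hAB, continuous_inclusion hAB⟩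
  rw [hA hγ, map_one] at key
  exact key

/-- The interior of a curve in a set with vanishing first homology is contained in that set. -/
theorem SCC.interiorSet_subset {X : Type*} [TopologicalSpace X] {γ : SCC X} {E : Set X}
    (hγ : γ.img ⊆ E) (hE : H1Trivial E) : γ.interiorSet ⊆ E := by
  intro z hz
  by_contra hzE
  refine hz.2 (SCC.NullhomologousIn.mono (fun h => hE _ (γ.pathIn E h)) hγ ?_)
  rintro w hw rfl
  exact hzE hw

/-! ### Angles and uniqueness of geodesics -/

theorem exists_euclCompAngle_le_of_upperAngleWrt_lt {Z : Type*} {d : Z → Z → ℝ} {p : Z}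
    {σ τ : ℝ → Z} {θ : ℝ} (h : upperAngleWrt d p σ τ < θ) :
    ∃ ε > 0, ∀ s t : ℝ, 0 < s → s < ε → 0 < t → t < ε →
      euclCompAngle (d p (σ s)) (d p (τ t)) (d (σ s) (τ t)) ≤ θ := by
  obtain ⟨_, ⟨ε, hε, rfl⟩, hlt⟩ := exists_lt_of_csInf_lt (by exact ⟨_, 1, one_pos, rfl⟩) h
  refine ⟨ε, hε, fun s t hs hsε ht htε => le_trans (le_csSup ?_ ?_) hlt.le⟩
  · refine ⟨Real.pi, ?_⟩
    rintro _ ⟨s, t, -, -, -, -, rfl⟩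
    exact Real.arccos_le_pi _
  · exact ⟨s, t, hs, hsε, ht, htε, rfl⟩

theorem cos_le_of_arccos_le {v θ : ℝ} (hθ : θ < Real.pi) (h : Real.arccos v ≤ θ) :
    Real.cos θ ≤ v := by
  rcases le_or_gt v (-1) with hv | hv
  · rw [Real.arccos_of_le_neg_one hv] at h
    exact absurd h (not_le.2 hθ)
  rcases le_or_gt v 1 with hv' | hv'
  · rw [← Real.cos_arccos hv.le hv']
    exact Real.cos_le_cos_of_nonneg_of_le_pi (Real.arccos_nonneg v) hθ.le h
  · exact (Real.cos_le_one θ).trans hv'.le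

/-- The base angles of an isosceles triangle in the model plane are acute. -/
theorem compAngle_lt_pi_div_two {κ : ℝ} (hκ : κ ≤ 0) {a b : ℝ} (ha : 0 < a) (hb : 0 < b) :
    compAngle κ a b a < Real.pi / 2 := by
  unfold compAngle euclCompAngle
  split_ifs with h
  · rw [Real.arccos_lt_pi_div_two]
    have : a ^ 2 + b ^ 2 - a ^ 2 = b ^ 2 := by ring
    rw [this]
    positivity
  · have hk : 0 < Real.sqrt (-κ) := Real.sqrt_pos.2 (by
      have := lt_of_le_of_ne hκ h
      linarith)
    rw [Real.arccos_lt_pi_div_two]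
    have h1 : 0 < Real.sinh (Real.sqrt (-κ) * a) := Real.sinh_pos_iff.2 (by positivity)
    have h2 : 0 < Real.sinh (Real.sqrt (-κ) * b) := Real.sinh_pos_iff.2 (by positivity)
    have h3 : 1 < Real.cosh (Real.sqrt (-κ) * b) := Real.one_lt_cosh.2 (by positivity)
    have h4 := Real.cosh_pos (Real.sqrt (-κ) * a)
    refine div_pos ?_ (by positivity)
    nlinarith

theorem IsGeodesicFromTo.dist_source {X : Type*} [MetricSpace X] {f : ℝ → X} {x y : X}
    (hf : IsGeodesicFromTo (xDist X) univ f x y) {s : ℝ} (hs : 0 ≤ s) (hs' : s ≤ dist x y) :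
    dist x (f s) = s := by
  have := hf.2.2.1.2 0 ⟨le_rfl, dist_nonneg⟩ s ⟨hs, hs'⟩
  rw [hf.1] at this
  simpa [abs_of_nonneg hs] using this

/-- At a base vertex of an isosceles triangle in a CAT(κ) space, the two sides diverge
at an acute angle. -/
theorem IsCATSpace.exists_dist_sq_le {κ : ℝ} (hκ : κ ≤ 0) {X : Type*} [MetricSpace X]
    (hX : IsCATSpace κ X) {p q z : X} (hpq : p ≠ q) (hpz : p ≠ z)
    (hiso : dist z q = dist p z) {σ ρ : ℝ → X}
    (hσ : IsGeodesicFromTo (xDist X) univ σ p z) (hρ : IsGeodesicFromTo (xDist X) univ ρ p q) :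
    ∃ ε > 0, ∃ c > 0, c ≤ 1 ∧ ∀ s t : ℝ, 0 < s → s < ε → 0 < t → t < ε →
      dist (σ s) (ρ t) ^ 2 ≤ s ^ 2 + t ^ 2 - 2 * s * t * c := by
  have hzq : z ≠ q := by
    rw [← dist_pos, hiso]
    exact dist_pos.2 hpz
  have hang : upperAngleWrt (xDist X) p σ ρ ≤ compAngle κ (dist p z) (dist p q) (dist z q) :=
    hX.2 p trivial z trivial q trivial hpz hpq hzq σ ρ hσ hρ
  have hlt : upperAngleWrt (xDist X) p σ ρ < Real.pi / 2 := by
    rw [hiso] at hang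
    exact hang.trans_lt (compAngle_lt_pi_div_two hκ (dist_pos.2 hpz) (dist_pos.2 hpq))
  obtain ⟨θ, hθ, hθ'⟩ := exists_between (max_lt hlt Real.pi_div_two_pos)
  obtain ⟨ε, hε, hle⟩ :=
    exists_euclCompAngle_le_of_upperAngleWrt_lt ((le_max_left _ _).trans_lt hθ)
  have hθ0 : 0 < θ := (le_max_right _ _).trans_lt hθ
  refine ⟨min ε (min (dist p z) (dist p q)),
    lt_min hε (lt_min (dist_pos.2 hpz) (dist_pos.2 hpq)), Real.cos θ,
    Real.cos_pos_of_mem_Ioo ⟨by linarith, hθ'⟩, Real.cos_le_one θ, ?_⟩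
  intro s t hs hs' ht ht'
  simp only [lt_min_iff] at hs' ht'
  have h := hle s t hs hs'.1 ht ht'.1
  simp only [hσ.dist_source hs.le hs'.2.1.le, hρ.dist_source ht.le ht'.2.2.le] at h
  have h' := cos_le_of_arccos_le (by linarith) h
  rw [le_div_iff₀ (by positivity)] at h'
  linarith

/-- Geodesics in a CAT(κ) space, `κ ≤ 0`, are unique. -/
theorem IsCATSpace.geodesic_unique {κ : ℝ} (hκ : κ ≤ 0) {X : Type*} [MetricSpace X]
    (hX : IsCATSpace κ X) {x y : X} {σ τ : ℝ → X}
    (hσ : IsGeodesicFromTo (xDist X) univ σ x y) (hτ : IsGeodesicFromTo (xDist X) univ τ x y)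
    {u : ℝ} (hu : u ∈ Icc 0 (dist x y)) : σ u = τ u := by
  by_contra hne
  have hσd : ∀ s ∈ Icc 0 (dist x y), ∀ t ∈ Icc 0 (dist x y), dist (σ s) (σ t) = |s - t| :=
    hσ.2.2.1.2
  have hτd : ∀ s ∈ Icc 0 (dist x y), ∀ t ∈ Icc 0 (dist x y), dist (τ s) (τ t) = |s - t| :=
    hτ.2.2.1.2
  have hσL : σ (dist x y) = y := hσ.2.1
  have hτL : τ (dist x y) = y := hτ.2.1
  have hu0 : 0 < u := by
    refine lt_of_le_of_ne hu.1 ?_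
    rintro rfl
    exact hne (hσ.1.trans hτ.1.symm)
  have huL : u < dist x y := by
    refine lt_of_le_of_ne hu.2 ?_
    rintro rfl
    exact hne (hσL.trans hτL.symm)
  have h0 : (0 : ℝ) ∈ Icc 0 (dist x y) := ⟨le_rfl, dist_nonneg⟩
  have hL : dist x y ∈ Icc 0 (dist x y) := ⟨dist_nonneg, le_rfl⟩
  have hpx : dist (σ u) x = u := by
    rw [← hσ.1, hσd u hu 0 h0, sub_zero, abs_of_pos hu0]
  have hpy : dist (σ u) y = dist x y - u := by
    have := hσd u hu _ hL
    rwa [hσL, abs_sub_comm, abs_of_pos (sub_pos.2 huL)] at this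
  have hqx : dist x (τ u) = u := hτ.dist_source hu.1 hu.2
  have hqy : dist y (τ u) = dist x y - u := by
    have := hτd _ hL u hu
    rwa [hτL, abs_of_pos (sub_pos.2 huL)] at this
  obtain ⟨ρ, hρ⟩ := hX.1 (σ u) trivial (τ u) trivial
  have hback : IsGeodesicFromTo (xDist X) univ (fun s => σ (u - s)) (σ u) x := by
    refine ⟨by simp, ?_, ⟨dist_nonneg, ?_⟩, fun _ _ => trivial⟩
    · simp only [hpx, sub_self, hσ.1]
    · simp only [hpx]
      intro s hs t ht
      change dist (σ (u - s)) (σ (u - t)) = |s - t|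
      rw [hσd _ ⟨by linarith [hs.2], by linarith [hs.1]⟩ _
        ⟨by linarith [ht.2], by linarith [ht.1]⟩, abs_sub_comm]
      congr 1
      ring
  have hforth : IsGeodesicFromTo (xDist X) univ (fun s => σ (u + s)) (σ u) y := by
    refine ⟨by simp, ?_, ⟨dist_nonneg, ?_⟩, fun _ _ => trivial⟩
    · simp only [hpy, add_sub_cancel, hσL]
    · simp only [hpy]
      intro s hs t ht
      change dist (σ (u + s)) (σ (u + t)) = |s - t|
      rw [hσd _ ⟨by linarith [hs.1], by linarith [hs.2]⟩ _
        ⟨by linarith [ht.1], by linarith [ht.2]⟩]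
      congr 1
      ring
  obtain ⟨ε₁, hε₁, c₁, hc₁, hc₁', h₁⟩ := hX.exists_dist_sq_le hκ hne
    (dist_pos.1 (by rw [hpx]; exact hu0)) (by rw [hqx, hpx]) hback hρ
  obtain ⟨ε₂, hε₂, c₂, hc₂, hc₂', h₂⟩ := hX.exists_dist_sq_le hκ hne
    (dist_pos.1 (by rw [hpy]; linarith)) (by rw [hqy, hpy]) hforth hρ
  obtain ⟨s, hs, hs'⟩ : ∃ s, 0 < s ∧ s < min (min ε₁ ε₂) (min u (dist x y - u)) :=
    exists_between (lt_min (lt_min hε₁ hε₂) (lt_min hu0 (sub_pos.2 huL)))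
  simp only [lt_min_iff] at hs'
  obtain ⟨⟨hs1, hs2⟩, hs3, hs4⟩ := hs'
  obtain ⟨c, hc, hcc₁, hcc₂⟩ : ∃ c > 0, c ≤ c₁ ∧ c ≤ c₂ :=
    ⟨min c₁ c₂, lt_min hc₁ hc₂, min_le_left _ _, min_le_right _ _⟩
  have hsc : 0 < s * c := mul_pos hs hc
  have hsc' : s * c ≤ s := mul_le_of_le_one_right hs.le (hcc₁.trans hc₁')
  have key : ∀ {D c' : ℝ}, c ≤ c' → D ^ 2 ≤ s ^ 2 + (s * c) ^ 2 - 2 * s * (s * c) * c' →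
      D < s := by
    intro D c' hc' hD
    have : 2 * s * (s * c) * c ≤ 2 * s * (s * c) * c' :=
      mul_le_mul_of_nonneg_left hc' (by positivity)
    exact lt_of_pow_lt_pow_left₀ 2 hs.le (by nlinarith [pow_pos hsc 2])
  have k₁ := key hcc₁ (h₁ s (s * c) hs hs1 hsc (by linarith))
  have k₂ := key hcc₂ (h₂ s (s * c) hs hs2 hsc (by linarith))
  have hd : dist (σ (u - s)) (σ (u + s)) = 2 * s := by
    rw [hσd _ ⟨by linarith, by linarith⟩ _ ⟨by linarith, by linarith⟩, abs_sub_comm,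
      abs_of_pos (by linarith)]
    ring
  have := dist_triangle_right (σ (u - s)) (σ (u + s)) (ρ (s * c))
  linarith

/-! ### The induced path metric -/

theorem dist_le_pathDistIn {X : Type*} [MetricSpace X] {E : Set X} (hE : RectConnected E)
    {x y : X} (hx : x ∈ E) (hy : y ∈ E) : dist x y ≤ pathDistIn E x y := by
  obtain ⟨g, hg, hgv⟩ := hE x hx y hy
  rw [dist_edist]
  refine ENNReal.toReal_mono (ne_top_of_le_ne_top hgv (iInf_le_of_le ⟨g, hg⟩ le_rfl))
    (le_iInf ?_)
  rintro ⟨f, -, h0, h1, -⟩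
  have := eVariationOn.edist_le f (s := Icc (0 : ℝ) 1) (x := 0) (y := 1) (by simp) (by simp)
  rwa [h0, h1] at this

/-- If a geodesic of the ambient space stays in `E`, the induced path metric between its
endpoints is at most the ambient distance. -/
theorem pathDistIn_le_dist {X : Type*} [MetricSpace X] {E : Set X} {x y : X} {g : ℝ → X}
    (hg : IsGeodesicFromTo (xDist X) univ g x y) (hE : MapsTo g (Icc 0 (dist x y)) E) :
    pathDistIn E x y ≤ dist x y := by
  have hlip : LipschitzOnWith 1 g (Icc 0 (dist x y)) :=
    LipschitzOnWith.of_dist_le_mul fun s hs t ht => by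
      rw [NNReal.coe_one, one_mul, Real.dist_eq]
      exact (hg.2.2.1.2 s hs t ht).le
  have hmaps : MapsTo (fun t : ℝ => dist x y * t) (Icc 0 1) (Icc 0 (dist x y)) := fun t ht =>
    ⟨mul_nonneg dist_nonneg ht.1, mul_le_of_le_one_right dist_nonneg ht.2⟩
  have hpath : IsPathIn E (g ∘ fun t => dist x y * t) x y :=
    ⟨hlip.continuousOn.comp (by fun_prop) hmaps, by simpa using hg.1, by simpa using hg.2.1,
      hE.comp hmaps⟩
  have hmono : Monotone fun t : ℝ => dist x y * t := fun s t h =>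
    mul_le_mul_of_nonneg_left h dist_nonneg
  have hvar : eVariationOn (fun t : ℝ => dist x y * t) (Icc 0 1) ≤
      ENNReal.ofReal (dist x y) := by
    have := (hmono.monotoneOn (Icc 0 1)).eVariationOn_eq (a := 0) (b := 1) (by simp) (by simp)
    simpa using this.le
  refine ENNReal.toReal_le_of_le_ofReal dist_nonneg (iInf_le_of_le ⟨_, hpath⟩ ?_)
  calc eVariationOn (g ∘ fun t => dist x y * t) (Icc 0 1)
      ≤ (1 : NNReal) * eVariationOn (fun t : ℝ => dist x y * t) (Icc 0 1) :=
        hlip.comp_eVariationOn_le hmaps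
    _ ≤ ENNReal.ofReal (dist x y) := by simpa using hvar

/-- A `1`-Lipschitz path on `[0, dist x y]` from `x` to `y` is a geodesic. -/
theorem isGeodesicFromTo_of_dist_le {X : Type*} [MetricSpace X] {x y : X} {h : ℝ → X}
    (h0 : h 0 = x) (h1 : h (dist x y) = y)
    (hle : ∀ s ∈ Icc 0 (dist x y), ∀ t ∈ Icc 0 (dist x y), dist (h s) (h t) ≤ |s - t|) :
    IsGeodesicFromTo (xDist X) univ h x y := by
  refine ⟨h0, h1, ⟨dist_nonneg, fun s hs t ht => ?_⟩, fun _ _ => trivial⟩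
  have key : ∀ s ∈ Icc 0 (dist x y), ∀ t ∈ Icc 0 (dist x y), s ≤ t →
      t - s ≤ dist (h s) (h t) := by
    intro s hs t ht hst
    have e0 := hle 0 ⟨le_rfl, dist_nonneg⟩ s hs
    have e1 := hle t ht (dist x y) ⟨dist_nonneg, le_rfl⟩
    rw [h0, zero_sub, abs_neg, abs_of_nonneg hs.1] at e0
    rw [h1, abs_sub_comm, abs_of_nonneg (sub_nonneg.2 ht.2)] at e1
    linarith [dist_triangle4 x (h s) (h t) y]
  refine le_antisymm (hle s hs t ht) ?_
  rcases le_total s t with hst | hst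
  · rw [abs_sub_comm, abs_of_nonneg (sub_nonneg.2 hst)]
    exact key s hs t ht hst
  · rw [abs_of_nonneg (sub_nonneg.2 hst)]
    change _ ≤ dist (h s) (h t)
    rw [dist_comm]
    exact key t ht s hs hst

end Cat2Cx

open Cat2Cx in
/-- **Lemma (prop3).**  Let `γ` be a simple closed curve in `E` and `α` a subarc of `γ`
that is geodesic in `Y`.  If `x, y ∈ α` are such that `[x,y]_X` lies in `γ ∪ Int γ`,
then `[x,y]_X ⊆ α`. -/
theorem x_geodesic_between_points_of_Y_geodesic_subarc
    {κ : ℝ} (hκ : κ ≤ 0) {X : Type*} [MetricSpace X]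
    (PC : PolyComplex2 κ X) (hX : IsCATSpace κ X)
    (E : Set X) (hEclosed : IsClosed E) (hErc : RectConnected E) (hH1 : H1Trivial ↥E)
    (γ : SCC X) (hγE : γ.img ⊆ E)
    (α : Set X) (hαγ : α ⊆ γ.img) (hα : IsYGeodesicArc E α)
    (x y : X) (hx : x ∈ α) (hy : y ∈ α)
    (hseg : geodSeg (xDist X) Set.univ x y ⊆ γ.img ∪ γ.interiorSet) :
    geodSeg (xDist X) Set.univ x y ⊆ α := by
  obtain ⟨f, a, b, ⟨-, hfd⟩, hfE, rfl⟩ := hα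
  obtain ⟨s, hs, rfl⟩ := hx
  obtain ⟨t, ht, rfl⟩ := hy
  intro z hz
  obtain ⟨g, hg, u, hu, rfl⟩ : ∃ g, IsGeodesicFromTo (xDist X) Set.univ g (f s) (f t) ∧
      ∃ u ∈ Set.Icc 0 (dist (f s) (f t)), g u = z := by
    simpa only [geodSeg, Set.mem_iUnion, exists_prop, Set.mem_image, Set.mem_ofPred_eq] using hz
  have hgE : Set.MapsTo g (Set.Icc 0 (dist (f s) (f t))) E := fun v hv =>
    Set.union_subset hγE (SCC.interiorSet_subset hγE hH1)
      (hseg (Set.mem_biUnion (show g ∈ {g | _} from hg) ⟨v, hv, rfl⟩))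
  have hD : dist (f s) (f t) = |s - t| := by
    rw [← hfd s hs t ht]
    exact le_antisymm (dist_le_pathDistIn hErc (hfE hs) (hfE ht)) (pathDistIn_le_dist hg hgE)
  obtain ⟨e, he, het, heab⟩ : ∃ e : ℝ, |e| = 1 ∧ s + e * |s - t| = t ∧
      ∀ v ∈ Set.Icc 0 |s - t|, s + e * v ∈ Set.Icc a b := by
    rcases le_total s t with hst | hst
    · rw [abs_sub_comm, abs_of_nonneg (sub_nonneg.2 hst)]
      exact ⟨1, by simp, by ring, fun v hv =>
        ⟨by linarith [hs.1, hv.1], by linarith [ht.2, hv.2]⟩⟩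
    · rw [abs_of_nonneg (sub_nonneg.2 hst)]
      exact ⟨-1, by simp, by ring, fun v hv =>
        ⟨by linarith [ht.1, hv.2], by linarith [hs.2, hv.1]⟩⟩
  rw [← hD] at heab het
  have hgeo : IsGeodesicFromTo (xDist X) Set.univ (fun v => f (s + e * v)) (f s) (f t) := by
    refine isGeodesicFromTo_of_dist_le (by simp) (by simp only [het]) fun v hv w hw => ?_
    refine (dist_le_pathDistIn hErc (hfE (heab v hv)) (hfE (heab w hw))).trans ?_
    rw [hfd _ (heab v hv) _ (heab w hw), add_sub_add_left_eq_sub, ← mul_sub, abs_mul, he,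
      one_mul]
  rw [hX.geodesic_unique hκ hg hgeo hu]
  exact ⟨_, heab u hu, rfl⟩
end
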